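/- arXiv:1208.1705 — 2 statements merged into one kernel-verified Lean document; each statement's English description precedes it below -/
import Mathlib

section
/- Let p be a prime element of 𝒪 with p ≡ 1 (mod 3), let w, B ∈ 𝒪 with wB coprime to p, and for integers j, k ≥ 1 set S(j,k) := ∑_{A (p^k)*} (A/p^k)₃ · e(p³·(wA)⁻¹/p^k) · ∑_{x (p^k)} e((A w² x³ + p^j B x)/p^k). Then: S(j,1) = φ(p)·(w/p)₃·g(1,p) for all j ≥ 1; S(j,3) = φ(p³)·N(p)² for all j ≥ 2; S(2,4) = N(p)⁵·( μ(p)·(w/p)₃·g(1,p) + N(p)·e(B³·(3³w)⁻¹/p) ); S(j,4) = N(p)⁵·( μ(p)·(w/p)₃·g(1,p) + N(p) ) for all j ≥ 3; S(2,k) = N(p)^{k+2}·e(B³·(3³w)⁻¹/p^{k−3}) for all k ≥ 5; and S(j,k) = 0 in all remaining cases (namely k = 2 with j ≥ 1; k = 3 with j = 1; k = 4 with j = 1; and k ≥ 5 with j ≠ 2). -/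
noncomputable section

namespace CubicSeries

open scoped Classical

def ω : ℂ := Complex.exp (2 * Real.pi * Complex.I / 3)

def O : Subring ℂ := Subring.closure {ω}

abbrev OK : Type _ := O

def δ : ℂ := ω - ω ^ 2

def eC (z : ℂ) : ℂ :=
  Complex.exp (2 * Real.pi * Complex.I * (z / δ + (starRingEnd ℂ) (z / δ)))

def rep {I : Ideal OK} (x : OK ⧸ I) : OK :=
  Function.surjInv Ideal.Quotient.mk_surjective x

/-- `N(c) = |𝒪/(c)|`, the absolute norm. -/
def Nm (c : OK) : ℕ := Nat.card (OK ⧸ Ideal.span {c})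

/-- `φ(c) = |(𝒪/(c))ˣ|`. -/
def totient (c : OK) : ℕ := Nat.card ((OK ⧸ Ideal.span {c})ˣ)

/-- a multiplicative inverse modulo `c` (an arbitrary element when `x` is not invertible). -/
def invMod (c x : OK) : OK :=
  rep (Ring.inverse (Ideal.Quotient.mk (Ideal.span {c}) x))

def T (A B c : OK) : ℂ :=
  ∑ᶠ x : OK ⧸ Ideal.span {c}, eC (((A * rep x ^ 3 + B * rep x : OK) : ℂ) / (c : ℂ))

/-- The cubic residue symbol `(x/π)₃` for a prime element `π` not dividing `3`:
the unique cube root of unity congruent to `x^{(N(π)-1)/3}` mod `π`, and `0` if `π ∣ x`. -/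
def cubicCharP (π x : OK) : OK :=
  if h : ∃ ζ : OK, ζ ^ 3 = 1 ∧ π ∣ ζ - x ^ ((Nm π - 1) / 3) ∧ ¬ π ∣ x then h.choose else 0

/-- The cubic residue symbol `(x/c)₃` for `c` coprime to `3`, defined via a factorization of
`c` into a unit times prime elements (with multiplicity). -/
def cubicChar (c x : OK) : OK :=
  if h : ∃ fs : OKˣ × Multiset OK, (∀ π ∈ fs.2, Prime π) ∧ c = (fs.1 : OK) * fs.2.prod
  then (h.choose.2.map fun π => cubicCharP π x).prod
  else 0

/-- The cubic Gauss sum `g(a,c) = ∑_{x (c)*} (x/c)₃ e(ax/c)`. -/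
def gaussSum (a c : OK) : ℂ :=
  ∑ᶠ u : (OK ⧸ Ideal.span {c})ˣ,
    ((cubicChar c (rep u.val) : OK) : ℂ) * eC (((a * rep u.val : OK) : ℂ) / (c : ℂ))

/-- The Möbius function: `μ(c) = (−1)^r` if `(c)` is a product of `r` distinct prime ideals,
and `μ(c) = 0` otherwise. -/
def moebius (c : OK) : ℤ :=
  if h : ∃ s : Finset (Ideal OK), (∀ P ∈ s, Prime P) ∧ Ideal.span {c} = ∏ P ∈ s, P
  then (-1) ^ h.choose.card
  else 0

/-- `p^n` modulo `c`, where a negative exponent means the inverse of `p^{-n}` mod `c`. -/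
def ppow (c p : OK) (n : ℤ) : OK :=
  if 0 ≤ n then p ^ n.toNat else invMod c (p ^ (-n).toNat)

/-- A choice of generator of a (principal) ideal. -/
def gen (J : Ideal OK) : OK := if h : ∃ q : OK, Ideal.span {q} = J then h.choose else 0

/-- A choice of cofactor: `cofactor c q` is a `d` with `c = q·d`, when one exists. -/
def cofactor (c q : OK) : OK := if h : ∃ d : OK, c = q * d then h.choose else 0


/-- The sum `S(j,k)` of Statement 9. -/
def S9 (p w B : OK) (j k : ℕ) : ℂ :=
  ∑ᶠ u : (OK ⧸ Ideal.span {p ^ k})ˣ,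
    ((cubicCharP p (rep u.val) ^ k : OK) : ℂ) *
      eC (((p ^ 3 * invMod (p ^ k) (w * rep u.val) : OK) : ℂ) / ((p ^ k : OK) : ℂ)) *
      ∑ᶠ t : OK ⧸ Ideal.span {p ^ k},
        eC (((rep u.val * w ^ 2 * rep t ^ 3 + p ^ j * B * rep t : OK) : ℂ) /
          ((p ^ k : OK) : ℂ))

section FieldPart

variable {F : Type} [Field F] [Fintype F]

lemma cube_roots_three (ζ : F) (h3 : (3 : F) ≠ 0) (hζ : ζ ^ 2 + ζ + 1 = 0) (u : F) (hu : u ≠ 0) :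
    (Finset.univ.filter (fun v : F => v ^ 3 = u ^ 3)).card = 3 := by
  have hz0 : ζ ≠ 0 := by rintro rfl; simp at hζ
  have hz1 : ζ ≠ 1 := by
    rintro rfl; apply h3; linear_combination hζ
  have hz2 : ζ ^ 2 ≠ 1 := by
    intro h; apply hz1
    have h2 : ζ = -2 := by linear_combination hζ - h
    rw [h2] at h ⊢
    have : (3:F) = 0 := by linear_combination h
    exact absurd this h3
  have hz12 : ζ ^ 2 ≠ ζ := by
    intro h; apply hz1
    have : ζ * (ζ - 1) = 0 := by linear_combination h
    rcases mul_eq_zero.1 this with h | h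
    · exact absurd h hz0
    · linear_combination h
  have : Finset.univ.filter (fun v : F => v ^ 3 = u ^ 3) = {u, ζ * u, ζ ^ 2 * u} := by
    ext v
    simp only [Finset.mem_filter, Finset.mem_univ, true_and, Finset.mem_insert,
      Finset.mem_singleton]
    constructor
    · intro h
      have : (v - u) * ((v - ζ * u) * (v - ζ ^ 2 * u)) = 0 := by
        linear_combination h + (-u*v^2+u^2*v*ζ - u^3*(ζ-1) +u^2*v*0) * hζ
      rcases mul_eq_zero.1 this with h | h
      · left; linear_combination h
      · rcases mul_eq_zero.1 h with h | h
        · right; left; linear_combination h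
        · right; right; linear_combination h
    · have hz3 : ζ ^ 3 = 1 := by linear_combination (ζ - 1) * hζ
      rintro (h | h | h) <;> rw [h]
      · linear_combination u ^ 3 * hz3
      · linear_combination u ^ 3 * (ζ^3 + 1) * hz3
  rw [this, Finset.card_eq_three]
  refine ⟨u, ζ * u, ζ ^ 2 * u, ?_, ?_, ?_, rfl⟩
  · intro h; apply hz1; field_simp at h; exact h.symm
  · intro h; apply hz2; field_simp at h; exact h.symm
  · intro h; apply hz12; exact (mul_right_cancel₀ hu h).symm

def kap (z : F) : ℤ := ((Finset.univ.filter (fun v : F => v ^ 3 = z)).card : ℤ)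

lemma kap_cube (ζ : F) (h3 : (3 : F) ≠ 0) (hζ : ζ ^ 2 + ζ + 1 = 0) (u : F) (hu : u ≠ 0) :
    kap (u ^ 3) = 3 := by
  unfold kap; rw [cube_roots_three ζ h3 hζ u hu]; rfl

lemma kap_noncube (z : F) (h : ∀ u, u ^ 3 ≠ z) : kap z = 0 := by
  unfold kap
  simp [Finset.filter_eq_empty_iff, h]

lemma card_le_one_nonsplit (ζ : F) (h3 : (3 : F) ≠ 0) (hζ : ζ ^ 2 + ζ + 1 = 0) (s t : F)
    (hs : s ≠ 0)
    (h : ∀ z : F, z ≠ 0 → z + s ^ 3 * z⁻¹ ≠ t) :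
    (Finset.univ.filter (fun C : F => C ^ 3 - 3 * s * C = t)).card ≤ 1 := by
  rw [Finset.card_le_one]
  intro C hC D hD
  simp only [Finset.mem_filter, Finset.mem_univ, true_and] at hC hD
  by_contra hne
  have hq : D ^ 2 + C * D + C ^ 2 - 3 * s = 0 := by
    have : (D - C) * (D ^ 2 + C * D + C ^ 2 - 3 * s) = 0 := by linear_combination hD - hC
    rcases mul_eq_zero.1 this with h | h
    · exact absurd (by linear_combination -h) hne
    · exact h
  have hd : (ζ - ζ ^ 2) ^ 2 = -3 := by
    linear_combination (ζ ^ 2 - 3 * ζ + 3) * hζ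
  have hd0 : ζ - ζ ^ 2 ≠ 0 := by
    intro h; rw [h] at hd; apply h3; linear_combination hd
  set d := ζ - ζ ^ 2 with hdd
  -- u = (D - ζ² C)/d, v = (ζ C - D)/d
  obtain ⟨u, hu⟩ : ∃ u, d * u = D - ζ ^ 2 * C := ⟨(D - ζ ^ 2 * C) / d, by field_simp⟩
  have huv : u * (C - u) = s := by
    have : 3 * (u * (C - u)) = 3 * s := by
      have e1 : d * (C - u) = ζ * C - D := by rw [mul_sub, hu, hdd]; ring
      have e2 : (d * u) * (d * (C - u)) = (D - ζ ^ 2 * C) * (ζ * C - D) := by rw [hu, e1]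
      have e3 : d ^ 2 * (u * (C - u)) = (D - ζ ^ 2 * C) * (ζ * C - D) := by
        rw [← e2]; ring
      rw [hd] at e3
      have hz3 : ζ ^ 3 = 1 := by linear_combination (ζ - 1) * hζ
      linear_combination -e3 + hq + C ^ 2 * hz3 - C * D * hζ
    exact mul_left_cancel₀ h3 this
  have hu0 : u ≠ 0 := by rintro rfl; apply hs; rw [← huv]; ring
  apply h (u ^ 3) (pow_ne_zero _ hu0)
  have hv : s ^ 3 * (u ^ 3)⁻¹ = (C - u) ^ 3 := by
    rw [← huv]; field_simp
  rw [hv, ← hC, ← huv]; ring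

lemma card_le_three (s t : F) :
    (Finset.univ.filter (fun C : F => C ^ 3 - 3 * s * C = t)).card ≤ 3 := by
  let P : Polynomial F := Polynomial.X ^ 3 - Polynomial.C (3 * s) * Polynomial.X - Polynomial.C t
  have hdeg : P.natDegree = 3 := by unfold P; compute_degree!
  have h0 : P ≠ 0 := by intro h; rw [h] at hdeg; simp at hdeg
  have : Finset.univ.filter (fun C : F => C ^ 3 - 3 * s * C = t) ⊆ P.roots.toFinset := by
    intro C hC
    simp only [Finset.mem_filter, Finset.mem_univ, true_and] at hC
    rw [Multiset.mem_toFinset, Polynomial.mem_roots h0, Polynomial.IsRoot.def]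
    simp [P, ← hC]
  calc _ ≤ P.roots.toFinset.card := Finset.card_le_card this
    _ ≤ P.roots.card := Multiset.toFinset_card_le _
    _ ≤ 3 := by rw [← hdeg]; exact P.card_roots'

lemma noncube_no_root (s t z : F) (hz : z ≠ 0) (ht : z + s ^ 3 * z⁻¹ = t)
    (hnc : ∀ u, u ^ 3 ≠ z) (C : F) (hC : C ^ 3 - 3 * s * C = t) : False := by
  have h1 : z * (C ^ 3 - 3 * s * C) = z ^ 2 + s ^ 3 := by
    rw [hC, ← ht]; field_simp
  by_cases hden : s * C + z = 0
  · have hzz : z = - (s * C) := by linear_combination hden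
    have h2 : (z ^ 2 - s ^ 3) ^ 2 = 0 := by
      have e : s ^ 3 * (z * (C ^ 3 - 3 * s * C)) = s ^ 3 * (z ^ 2 + s ^ 3) := by rw [h1]
      have e2 : s * C = - z := by linear_combination hden
      have e3 : s ^ 3 * (z * (C ^ 3 - 3 * s * C)) = z * ((s * C) ^ 3 - 3 * s ^ 3 * (s * C)) := by ring
      rw [e3, e2] at e
      linear_combination -e
    have h3 : z ^ 2 = s ^ 3 := by
      have := pow_eq_zero_iff (two_ne_zero) |>.1 h2
      linear_combination this
    apply hnc (z / s)
    rw [div_pow, ← h3]; field_simp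
  · apply hnc ((C * z + s ^ 2) / (s * C + z))
    rw [div_pow, div_eq_iff (pow_ne_zero _ hden)]
    linear_combination (z ^ 2 - s ^ 3) * h1

lemma key_le (ζ : F) (h3 : (3 : F) ≠ 0) (hζ : ζ ^ 2 + ζ + 1 = 0) (s t : F) (hs : s ≠ 0) :
    2 * ((Finset.univ.filter (fun C : F => C ^ 3 - 3 * s * C = t)).card : ℤ) ≤
    2 + ∑ z ∈ Finset.univ.filter (fun z : F => z ≠ 0 ∧ z + s ^ 3 * z⁻¹ = t), (kap z - 1) := by
  by_cases hns : ∀ z : F, z ≠ 0 → z + s ^ 3 * z⁻¹ ≠ t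
  · have h1 := card_le_one_nonsplit ζ h3 hζ s t hs hns
    have : Finset.univ.filter (fun z : F => z ≠ 0 ∧ z + s ^ 3 * z⁻¹ = t) = ∅ := by
      rw [Finset.filter_eq_empty_iff]
      rintro z - ⟨h1, h2⟩
      exact hns z h1 h2
    rw [this, Finset.sum_empty]; omega
  push Not at hns
  obtain ⟨z, hz, hzt⟩ := hns
  set z' := s ^ 3 * z⁻¹ with hz'
  have hzz' : z * z' = s ^ 3 := by rw [hz']; field_simp
  have hz'0 : z' ≠ 0 := by rw [hz']; positivity
  have hset : Finset.univ.filter (fun z : F => z ≠ 0 ∧ z + s ^ 3 * z⁻¹ = t) = {z, z'} := by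
    ext y
    simp only [Finset.mem_filter, Finset.mem_univ, true_and, Finset.mem_insert,
      Finset.mem_singleton]
    constructor
    · rintro ⟨hy, h⟩
      have : (y - z) * (y - z') = 0 := by
        have e : y ^ 2 + s ^ 3 = y * t := by rw [← h]; field_simp
        linear_combination e - y * hzt + hzz'
      rcases mul_eq_zero.1 this with h | h
      · left; linear_combination h
      · right; linear_combination h
    · rintro (h | h)
      · subst h; exact ⟨hz, hzt⟩
      · subst h; refine ⟨hz'0, ?_⟩
        rw [← hzz']; field_simp; rw [← hzt]; ring
  rw [hset]
  by_cases hc : ∃ u, u ^ 3 = z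
  · obtain ⟨u, hu⟩ := hc
    have hu0 : u ≠ 0 := by rintro rfl; apply hz; rw [← hu]; ring
    have hu' : (s / u) ^ 3 = z' := by rw [div_pow, hu, hz', div_eq_mul_inv]
    have k1 : kap z = 3 := by rw [← hu]; exact kap_cube ζ h3 hζ u hu0
    have k2 : kap z' = 3 := by
      rw [← hu']; exact kap_cube ζ h3 hζ _ (div_ne_zero hs hu0)
    by_cases heq : z = z'
    · have : ({z, z'} : Finset F) = {z} := by rw [← heq]; simp
      rw [this, Finset.sum_singleton, k1]
      -- pick the right cube root
      have hz3 : ζ ^ 3 = 1 := by linear_combination (ζ - 1) * hζ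
      obtain ⟨v, hv3, hv2⟩ : ∃ v, v ^ 3 = z ∧ v ^ 2 = s := by
        refine ⟨z / s, ?_, ?_⟩
        · have : s ^ 3 = z ^ 2 := by rw [← hzz', ← heq]; ring
          rw [div_pow, this]; field_simp
        · have : s ^ 3 = z ^ 2 := by rw [← hzz', ← heq]; ring
          rw [div_pow, ← this]; field_simp
      have : Finset.univ.filter (fun C : F => C ^ 3 - 3 * s * C = t) ⊆ {2 * v, - v} := by
        intro C hC
        simp only [Finset.mem_filter, Finset.mem_univ, true_and, Finset.mem_insert,
          Finset.mem_singleton] at hC ⊢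
        have e : (C - 2 * v) * (C + v) ^ 2 = 0 := by
          rw [← heq, ← hv3] at hzt
          rw [← hzt, ← hv2] at hC
          linear_combination hC
        rcases mul_eq_zero.1 e with h | h
        · left; linear_combination h
        · right
          have := pow_eq_zero_iff (two_ne_zero) |>.1 h
          linear_combination this
      have := (Finset.card_le_card this).trans Finset.card_le_two
      omega
    · rw [Finset.sum_pair heq, k1, k2]
      have := card_le_three s t
      omega
  · push Not at hc
    have h0 : Finset.univ.filter (fun C : F => C ^ 3 - 3 * s * C = t) = ∅ := by
      rw [Finset.filter_eq_empty_iff]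
      rintro C - hC
      exact noncube_no_root s t z hz hzt hc C hC
    have hc' : ∀ u, u ^ 3 ≠ z' := by
      intro u hu
      have hu0 : u ≠ 0 := by rintro rfl; apply hz'0; rw [← hu]; ring
      apply hc (s / u)
      rw [div_pow, hu, ← hzz']; field_simp
    rw [h0]
    have k1 := kap_noncube z hc
    have k2 := kap_noncube z' hc'
    by_cases heq : z = z'
    · have : ({z, z'} : Finset F) = {z} := by rw [← heq]; simp
      rw [this, Finset.sum_singleton, k1]; simp
    · rw [Finset.sum_pair heq, k1, k2]; simp

lemma key_eq (ζ : F) (h3 : (3 : F) ≠ 0) (hζ : ζ ^ 2 + ζ + 1 = 0) (s : F) (hs : s ≠ 0) (t : F) :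
    2 * ((Finset.univ.filter (fun C : F => C ^ 3 - 3 * s * C = t)).card : ℤ) =
    2 + ∑ z ∈ Finset.univ.filter (fun z : F => z ≠ 0 ∧ z + s ^ 3 * z⁻¹ = t), (kap z - 1) := by
  have hle := fun t => key_le ζ h3 hζ s t hs
  have hsum : ∑ t : F, 2 * ((Finset.univ.filter (fun C : F => C ^ 3 - 3 * s * C = t)).card : ℤ) =
    ∑ t : F, (2 + ∑ z ∈ Finset.univ.filter (fun z : F => z ≠ 0 ∧ z + s ^ 3 * z⁻¹ = t),
      (kap z - 1)) := by
    have e1 : ∑ t : F, (Finset.univ.filter (fun C : F => C ^ 3 - 3 * s * C = t)).card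
        = Fintype.card F :=
      (Finset.card_eq_sum_card_fiberwise (s := (Finset.univ : Finset F)) (t := Finset.univ)
        (f := fun C : F => C ^ 3 - 3 * s * C) (by intro x _; simp)).symm
    have e2 : ∑ t : F, ∑ z ∈ Finset.univ.filter (fun z : F => z ≠ 0 ∧ z + s ^ 3 * z⁻¹ = t),
        (kap z - 1) = ∑ z ∈ Finset.univ.filter (fun z : F => z ≠ 0), (kap z - 1) := by
      rw [← Finset.sum_fiberwise (Finset.univ.filter (fun z : F => z ≠ 0))
        (fun z => z + s ^ 3 * z⁻¹)]
      simp only [Finset.filter_filter]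
    have e3 : ∑ z : F, kap z = Fintype.card F := by
      unfold kap
      exact_mod_cast (Finset.card_eq_sum_card_fiberwise (s := (Finset.univ : Finset F))
        (t := Finset.univ)
        (f := fun C : F => C ^ (3:ℕ)) (by intro x _; simp)).symm
    have e4 : kap (0 : F) = 1 := by
      unfold kap
      have : Finset.univ.filter (fun v : F => v ^ 3 = 0) = {0} := by
        ext v; simp
      rw [this]; simp
    have e5 : ∑ z ∈ Finset.univ.filter (fun z : F => z ≠ 0), (kap z - 1) = 0 := by
      have : ∑ z : F, (kap z - 1) = 0 := by
        rw [Finset.sum_sub_distrib, e3]; simp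
      rw [← this, Finset.filter_ne', ← Finset.add_sum_erase _ _ (Finset.mem_univ (0:F)), e4]
      simp
    rw [Finset.sum_add_distrib, e2, e5, ← Finset.mul_sum]
    have : ∑ t : F, ((Finset.univ.filter (fun C : F => C ^ 3 - 3 * s * C = t)).card : ℤ)
        = Fintype.card F := by exact_mod_cast e1
    rw [this]; simp [mul_comm]
  exact (Finset.sum_eq_sum_iff_of_le (fun t _ => hle t)).1 hsum t (Finset.mem_univ t)

lemma kap_char (ζ : F) (h3 : (3 : F) ≠ 0) (hζ : ζ ^ 2 + ζ + 1 = 0) (X : MulChar F ℂ)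
    (hX3 : X ^ 3 = 1) (hX1 : X ≠ 1) (z : F) (hz : z ≠ 0) :
    ((kap z : ℤ) : ℂ) = 1 + X z + X z ^ 2 := by
  have hc3 : ∀ u : F, u ≠ 0 → X u ^ 3 = 1 := by
    intro u hu
    rw [← MulChar.pow_apply' X three_ne_zero, hX3, MulChar.one_apply hu.isUnit]
  by_cases hc : ∃ u, u ^ 3 = z
  · obtain ⟨u, rfl⟩ := hc
    have hu : u ≠ 0 := by rintro rfl; simp at hz
    rw [kap_cube ζ h3 hζ u hu, map_pow, hc3 u hu]; norm_num
  · push Not at hc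
    rw [kap_noncube z hc]
    have hne : X z ≠ 1 := by
      intro h1
      obtain ⟨g, hg⟩ := IsCyclic.exists_generator (α := Fˣ)
      have hg1 : X (g : F) ≠ 1 := by
        intro h
        apply hX1
        ext a
        obtain ⟨n, hn⟩ := hg a
        simp only at hn
        rw [← hn, MulChar.one_apply (Units.isUnit _)]
        rw [← MulChar.coe_toUnitHom] 
        have : MulChar.toUnitHom X g = 1 := by
          ext; rw [MulChar.coe_toUnitHom, h]; simp
        rw [map_zpow, this]; simp
      obtain ⟨n, hn⟩ := (mem_powers_iff_mem_zpowers).2 (hg (Units.mk0 z hz))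
      simp only at hn
      have hzn : z = (g : F) ^ n := by
        have := congrArg Units.val hn
        simpa using this.symm
      rw [hzn, map_pow] at h1
      have h3n : ¬ 3 ∣ n := by
        rintro ⟨m, rfl⟩
        apply hc ((g:F) ^ m)
        rw [hzn, ← pow_mul, mul_comm]
      have hg3 := hc3 g g.ne_zero
      have hcop : Nat.Coprime n 3 := by
        rw [Nat.coprime_comm, Nat.Prime.coprime_iff_not_dvd Nat.prime_three]; exact h3n
      apply hg1
      have := pow_gcd_eq_one.2 ⟨h1, hg3⟩
      rw [hcop] at this; simpa using this
    have h3' := hc3 z hz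
    have : (X z - 1) * (1 + X z + X z ^ 2) = 0 := by linear_combination h3'
    rcases mul_eq_zero.1 this with h | h
    · exact absurd (by linear_combination h) hne
    · rw [h]; simp

end FieldPart


section FieldPart2

variable {F : Type} [Field F] [Fintype F]

lemma X_zero (X : MulChar F ℂ) : X (0 : F) = 0 := X.map_nonunit not_isUnit_zero

lemma X_cube (X : MulChar F ℂ) (hX3 : X ^ 3 = 1) (u : F) (hu : u ≠ 0) : X u ^ 3 = 1 := by
  rw [← MulChar.pow_apply' X three_ne_zero, hX3, MulChar.one_apply hu.isUnit]

lemma X_inv (X : MulChar F ℂ) (hX3 : X ^ 3 = 1) (u : F) : X u⁻¹ = X u ^ 2 := by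
  by_cases hu : u = 0
  · subst hu; simp [X_zero]
  · have h1 : X u⁻¹ * X u = 1 := by rw [← map_mul, inv_mul_cancel₀ hu, map_one]
    have h3 := X_cube X hX3 u hu
    linear_combination X u ^ 2 * h1 - X u⁻¹ * h3

lemma sum_inv_eq (f : F → ℂ) : ∑ z, f z⁻¹ = ∑ z, f z :=
  Equiv.sum_comp (inv_involutive (G := F)).toPerm f

lemma sum_shift_char (ψ : AddChar F ℂ) (X : MulChar F ℂ) (hX3 : X ^ 3 = 1) (c : F) (hc : c ≠ 0) :
    ∑ z, X z * ψ (c * z) = X c ^ 2 * ∑ z, X z * ψ z := by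
  rw [Finset.mul_sum, ← Equiv.sum_comp (Equiv.mulLeft₀ c⁻¹ (inv_ne_zero hc))]
  refine Finset.sum_congr rfl fun z _ => ?_
  simp only [Equiv.mulLeft₀_apply]
  rw [map_mul, X_inv X hX3, mul_inv_cancel_left₀ hc]; ring

lemma twisted_kloosterman (ψ : AddChar F ℂ) (hψ : ψ.IsPrimitive) (ζ : F) (h3 : (3 : F) ≠ 0)
    (hζ : ζ ^ 2 + ζ + 1 = 0) (X : MulChar F ℂ)
    (hX3 : X ^ 3 = 1) (hX1 : X ≠ 1) (s a : F) (hs : s ≠ 0) (ha : a ≠ 0) :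
    ∑ z, X z ^ 2 * ψ (a * (z + s ^ 3 * z⁻¹)) = ∑ C, ψ (a * (C ^ 3 - 3 * s * C)) := by
  have e0 : ∑ t, ψ (a * t) = 0 := by
    have := AddChar.sum_mulShift a hψ
    rw [if_neg ha, Nat.cast_zero] at this
    rw [← this]; exact Finset.sum_congr rfl fun t _ => by rw [mul_comm]
  have e1 : ∑ z ∈ Finset.univ.filter (fun z : F => z ≠ 0),
      ((kap z - 1 : ℤ) : ℂ) * ψ (a * (z + s ^ 3 * z⁻¹)) =
      2 * ∑ C, ψ (a * (C ^ 3 - 3 * s * C)) := by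
    calc _ = ∑ t, ∑ z ∈ Finset.univ.filter (fun z : F => z ≠ 0 ∧ z + s ^ 3 * z⁻¹ = t),
          ((kap z - 1 : ℤ) : ℂ) * ψ (a * t) := by
            rw [← Finset.sum_fiberwise (Finset.univ.filter (fun z : F => z ≠ 0))
              (fun z => z + s ^ 3 * z⁻¹)]
            simp only [Finset.filter_filter]
            refine Finset.sum_congr rfl fun t _ => Finset.sum_congr rfl fun z hz => ?_
            rw [(Finset.mem_filter.1 hz).2.2]
      _ = ∑ t, ((2 * ((Finset.univ.filter (fun C : F => C ^ 3 - 3 * s * C = t)).card : ℤ) - 2 : ℤ)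
            : ℂ) * ψ (a * t) := by
            refine Finset.sum_congr rfl fun t _ => ?_
            rw [key_eq ζ h3 hζ s hs t, ← Finset.sum_mul, ← Int.cast_sum]
            congr 2; ring
      _ = 2 * ∑ t, ∑ C ∈ Finset.univ.filter (fun C : F => C ^ 3 - 3 * s * C = t), ψ (a * t) := by
            have : ∀ t, ((2 * ((Finset.univ.filter (fun C : F => C ^ 3 - 3 * s * C = t)).card : ℤ)
              - 2 : ℤ) : ℂ) * ψ (a * t) = 2 * ∑ C ∈ Finset.univ.filter
              (fun C : F => C ^ 3 - 3 * s * C = t), ψ (a * t) - 2 * ψ (a * t) := by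
                intro t; rw [Finset.sum_const, nsmul_eq_mul]; push_cast; ring
            rw [Finset.sum_congr rfl fun t _ => this t, Finset.sum_sub_distrib, ← Finset.mul_sum,
              ← Finset.mul_sum, e0]; ring
      _ = _ := by
            congr 1
            rw [← Finset.sum_fiberwise Finset.univ (fun C : F => C ^ 3 - 3 * s * C)
              (fun C => ψ (a * (C ^ 3 - 3 * s * C)))]
            refine Finset.sum_congr rfl fun t _ => Finset.sum_congr rfl fun z hz => ?_
            rw [(Finset.mem_filter.1 hz).2]
  have e2 : ∑ z ∈ Finset.univ.filter (fun z : F => z ≠ 0),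
      ((kap z - 1 : ℤ) : ℂ) * ψ (a * (z + s ^ 3 * z⁻¹)) =
      ∑ z, (X z + X z ^ 2) * ψ (a * (z + s ^ 3 * z⁻¹)) := by
    rw [Finset.sum_filter]
    refine Finset.sum_congr rfl fun z _ => ?_
    split_ifs with hz
    · push_cast; rw [kap_char ζ h3 hζ X hX3 hX1 z hz]; ring
    · push Not at hz; subst hz; simp [X_zero]
  have e3 : ∑ z, X z * ψ (a * (z + s ^ 3 * z⁻¹)) =
      ∑ z, X z ^ 2 * ψ (a * (z + s ^ 3 * z⁻¹)) := by
    have hs3 : s ^ 3 ≠ 0 := pow_ne_zero _ hs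
    have hinv : Function.Involutive (fun z : F => s ^ 3 * z⁻¹) := by
      intro z
      by_cases hz : z = 0
      · subst hz; simp
      · simp only; field_simp
    rw [← Equiv.sum_comp hinv.toPerm]
    refine Finset.sum_congr rfl fun z _ => ?_
    simp only [Function.Involutive.coe_toPerm]
    have := hinv z
    simp only at this
    rw [this, map_mul, map_pow, X_cube X hX3 s hs, X_inv X hX3, one_mul, add_comm]
  have : (2:ℂ) * ∑ z, X z ^ 2 * ψ (a * (z + s ^ 3 * z⁻¹)) =
      2 * ∑ C, ψ (a * (C ^ 3 - 3 * s * C)) := by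
    rw [← e1, e2]
    simp only [add_mul, Finset.sum_add_distrib]
    rw [e3]; ring
  exact mul_left_cancel₀ two_ne_zero this

lemma cube_sum (ψ : AddChar F ℂ) (hψ : ψ.IsPrimitive) (ζ : F) (h3 : (3 : F) ≠ 0)
    (hζ : ζ ^ 2 + ζ + 1 = 0) (X : MulChar F ℂ)
    (hX3 : X ^ 3 = 1) (hX1 : X ≠ 1) (a : F) (ha : a ≠ 0) :
    ∑ C, ψ (a * C ^ 3) = ∑ z, X z * ψ (a * z) + ∑ z, X z ^ 2 * ψ (a * z) := by
  have e0 : ∑ t, ψ (a * t) = 0 := by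
    have := AddChar.sum_mulShift a hψ
    rw [if_neg ha, Nat.cast_zero] at this
    rw [← this]; exact Finset.sum_congr rfl fun t _ => by rw [mul_comm]
  have e4 : kap (0 : F) = 1 := by
    unfold kap
    have : Finset.univ.filter (fun v : F => v ^ 3 = 0) = {0} := by
      ext v; simp
    rw [this]; simp
  calc _ = ∑ t, ((kap t : ℤ) : ℂ) * ψ (a * t) := by
        rw [← Finset.sum_fiberwise Finset.univ (fun C : F => C ^ 3)]
        refine Finset.sum_congr rfl fun t _ => ?_
        unfold kap
        rw [Int.cast_natCast, ← nsmul_eq_mul, ← Finset.sum_const]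
        refine Finset.sum_congr rfl fun z hz => ?_
        rw [(Finset.mem_filter.1 hz).2]
    _ = ∑ t, (1 + X t + X t ^ 2) * ψ (a * t) := by
        refine Finset.sum_congr rfl fun t _ => ?_
        by_cases ht : t = 0
        · subst ht; rw [e4]; simp [X_zero]
        · rw [kap_char ζ h3 hζ X hX3 hX1 t ht]
    _ = _ := by simp only [add_mul, one_mul, Finset.sum_add_distrib]; rw [e0]; ring

/-- The evaluation needed for `k = 4`. -/
lemma field_eval (ψ : AddChar F ℂ) (hψ : ψ.IsPrimitive) (ζ : F) (h3 : (3 : F) ≠ 0)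
    (hζ : ζ ^ 2 + ζ + 1 = 0) (X : MulChar F ℂ)
    (hX3 : X ^ 3 = 1) (hX1 : X ≠ 1) (w b : F) (hw : w ≠ 0) :
    ∑ A, X A * ∑ y, ψ ((w * A)⁻¹ + A * w ^ 2 * y ^ 3 + b * y) =
      - (X w * ∑ z, X z * ψ z) + (Fintype.card F : ℂ) * ψ (b ^ 3 * (3 ^ 3 * w)⁻¹) := by
  have hwi : w⁻¹ ≠ 0 := inv_ne_zero hw
  have hXw : X w⁻¹ ^ 2 = X w := by
    rw [X_inv X hX3]
    have := X_cube X hX3 w hw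
    linear_combination X w * this
  have hK : ∀ y : F, ∑ A, X A * ψ ((w * A)⁻¹ + A * w ^ 2 * y ^ 3) =
      (if y = 0 then - (X w * ∑ z, X z * ψ z) else 0) +
      ∑ C, ψ (w⁻¹ * (C ^ 3 - 3 * (w * y) * C)) := by
    intro y
    rw [← sum_inv_eq]
    simp only [X_inv X hX3]
    split_ifs with hy
    · subst hy
      have := cube_sum ψ hψ ζ h3 hζ X hX3 hX1 w⁻¹ hwi
      rw [sum_shift_char ψ X hX3 _ hwi, hXw] at this
      simp only [mul_zero, zero_mul, sub_zero, ne_eq, OfNat.ofNat_ne_zero, not_false_eq_true,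
        zero_pow, add_zero, mul_inv, inv_inv]
      rw [this]; ring
    · rw [zero_add, ← twisted_kloosterman ψ hψ ζ h3 hζ X hX3 hX1 (w * y) w⁻¹
        (mul_ne_zero hw hy) hwi]
      refine Finset.sum_congr rfl fun z _ => ?_
      congr 2
      rw [mul_inv, inv_inv]; field_simp
  calc _ = ∑ y, ψ (b * y) * ∑ A, X A * ψ ((w * A)⁻¹ + A * w ^ 2 * y ^ 3) := by
        simp only [Finset.mul_sum]
        rw [Finset.sum_comm]
        refine Finset.sum_congr rfl fun y _ => Finset.sum_congr rfl fun A _ => ?_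
        rw [AddChar.map_add_eq_mul]; ring
    _ = ∑ y, ψ (b * y) * (if y = 0 then - (X w * ∑ z, X z * ψ z) else 0) +
        ∑ y, ∑ C, ψ (w⁻¹ * C ^ 3) * ψ (y * (b - 3 * C)) := by
        rw [← Finset.sum_add_distrib]
        refine Finset.sum_congr rfl fun y _ => ?_
        rw [hK, mul_add]
        congr 1
        rw [Finset.mul_sum]
        refine Finset.sum_congr rfl fun C _ => ?_
        rw [← AddChar.map_add_eq_mul, ← AddChar.map_add_eq_mul]
        congr 1; field_simp; ring
    _ = _ := by
        congr 1
        · rw [Finset.sum_eq_single 0]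
          · simp
          · intro y _ hy; simp [hy]
          · simp
        · rw [Finset.sum_comm]
          simp only [← Finset.mul_sum]
          simp only [AddChar.sum_mulShift _ hψ]
          rw [Finset.sum_eq_single (b / 3)]
          · have : b - 3 * (b / 3) = 0 := by field_simp; ring
            rw [if_pos this, mul_comm]
            congr 2; field_simp
          · intro C _ hC
            rw [if_neg]
            · simp
            · intro h; apply hC; field_simp; linear_combination -h
          · simp

/-- The evaluation needed for `k = 1`. -/
lemma field_eval_one (ψ : AddChar F ℂ) (X : MulChar F ℂ)
    (hX3 : X ^ 3 = 1) (hX1 : X ≠ 1) (w : F) (hw : w ≠ 0) :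
    ∑ A, X A * ∑ x, ψ (A * w ^ 2 * x ^ 3) =
      ((Fintype.card F : ℂ) - 1) * X w * ∑ z, X z * ψ z := by
  have h : ∀ x : F, ∑ A, X A * ψ (A * w ^ 2 * x ^ 3) =
      (1 - if x = 0 then 1 else 0) * (X w * ∑ z, X z * ψ z) := by
    intro x
    split_ifs with hx
    · subst hx
      simp [MulChar.sum_eq_zero_of_ne_one hX1]
    · have := sum_shift_char ψ X hX3 (w ^ 2 * x ^ 3) (by positivity)
      rw [map_mul, map_pow, map_pow, X_cube X hX3 x hx] at this
      have hw3 := X_cube X hX3 w hw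
      rw [sub_zero, one_mul]
      calc _ = ∑ z, X z * ψ (w ^ 2 * x ^ 3 * z) := by
            refine Finset.sum_congr rfl fun z _ => ?_
            congr 2; ring
        _ = _ := by rw [this]; congr 1; linear_combination X w * hw3
  simp only [Finset.mul_sum] at h ⊢
  rw [Finset.sum_comm]
  rw [Finset.sum_congr rfl fun x _ => h x]
  rw [Finset.sum_comm]
  refine Finset.sum_congr rfl fun z _ => ?_
  rw [← Finset.sum_mul, Finset.sum_sub_distrib]
  simp; ring

end FieldPart2


section RingPart

structure LR {R : Type} [CommRing R] [Fintype R] (π : R) (k N : ℕ) (ψ : AddChar R ℂ) : Prop where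
  hk : 1 ≤ k
  hN : N ≠ 0
  unit_or : ∀ x, IsUnit x ∨ π ∣ x
  not_unit : ¬ IsUnit π
  ann : ∀ i ≤ k, ∀ x, π ^ i * x = 0 ↔ π ^ (k - i) ∣ x
  card : Fintype.card R = N ^ k
  cardAnn : (Finset.univ.filter (fun x : R => π * x = 0)).card = N
  ortho : ∀ x, (∀ t, ψ (x * t) = 1) → x = 0

variable {R : Type} [CommRing R] [Fintype R] {π : R} {k N : ℕ} {ψ : AddChar R ℂ}

namespace LR

lemma pik (h : LR π k N ψ) : π ^ k = 0 := by
  have := (h.ann k le_rfl 1).2 (by simp)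
  simpa using this

lemma pi_ge (h : LR π k N ψ) {m : ℕ} (hm : k ≤ m) : π ^ m = 0 := by
  obtain ⟨l, rfl⟩ := Nat.exists_eq_add_of_le hm
  rw [pow_add, h.pik, zero_mul]

lemma dvd_iff (h : LR π k N ψ) (x : R) : π ^ (k - 1) * x = 0 ↔ π ∣ x := by
  rw [h.ann (k - 1) (by omega)]
  have := h.hk
  rw [show k - (k - 1) = 1 by omega, pow_one]

lemma not_dvd_of_unit (h : LR π k N ψ) {x : R} (hx : IsUnit x) : ¬ π ∣ x := fun hd =>
  h.not_unit (isUnit_of_dvd_unit hd hx)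

lemma not_dvd_iff (h : LR π k N ψ) {x : R} : ¬ π ∣ x ↔ IsUnit x :=
  ⟨fun hx => (h.unit_or x).resolve_right hx, h.not_dvd_of_unit⟩

lemma dvd_mul_unit (_h : LR π k N ψ) {x y : R} (hx : IsUnit x) : π ∣ x * y ↔ π ∣ y :=
  hx.dvd_mul_left

lemma prime (h : LR π k N ψ) {x y : R} (hd : π ∣ x * y) : π ∣ x ∨ π ∣ y := by
  by_contra hc
  push Not at hc
  exact h.not_dvd_of_unit ((h.not_dvd_iff.1 hc.1).mul (h.not_dvd_iff.1 hc.2)) hd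

lemma dvd_of_pow (h : LR π k N ψ) {x : R} (n : ℕ) (hd : π ∣ x ^ n) : π ∣ x := by
  by_contra hc
  exact h.not_dvd_of_unit ((h.not_dvd_iff.1 hc).pow n) hd

lemma unit_add (h : LR π k N ψ) {x y : R} (hx : IsUnit x) (hy : π ∣ y) : IsUnit (x + y) := by
  rw [← h.not_dvd_iff] at hx ⊢
  rwa [dvd_add_left hy]

lemma sum_ortho (h : LR π k N ψ) (x : R) :
    ∑ t, ψ (x * t) = if x = 0 then (N : ℂ) ^ k else 0 := by
  split_ifs with hx
  · subst hx
    simp [h.card]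
  · have : AddChar.mulShift ψ x ≠ 1 := by
      intro h1
      apply hx
      apply h.ortho
      intro t
      have := DFunLike.congr_fun h1 t
      simpa [AddChar.mulShift_apply] using this
    exact AddChar.sum_eq_zero_of_ne_one this

lemma NC (h : LR π k N ψ) : (N : ℂ) ≠ 0 := by exact_mod_cast h.hN

lemma restrict (h : LR π k N ψ) (F : R → ℂ) (ε : R) (d : R → R)
    (hF : ∀ x t, F (x + ε * t) = F x * ψ (d x * t)) :
    ∑ x, F x = ∑ x, if d x = 0 then F x else 0 := by
  have e : ∑ t : R, ∑ x, F (x + ε * t) = (N : ℂ) ^ k * ∑ x, F x := by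
    have : ∀ t : R, ∑ x, F (x + ε * t) = ∑ x, F x := fun t =>
      Equiv.sum_comp (Equiv.addRight (ε * t)) F
    rw [Finset.sum_congr rfl fun t _ => this t]
    simp [h.card]
  have e2 : ∑ t : R, ∑ x, F (x + ε * t) = (N : ℂ) ^ k * ∑ x, if d x = 0 then F x else 0 := by
    rw [Finset.sum_comm, Finset.mul_sum]
    refine Finset.sum_congr rfl fun x _ => ?_
    simp only [hF]
    rw [← Finset.mul_sum, h.sum_ortho]
    split_ifs <;> ring
  exact mul_left_cancel₀ (pow_ne_zero k h.NC) (e.symm.trans e2)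

lemma sum_dvd (h : LR π k N ψ) (F : R → ℂ) :
    (N : ℂ) * ∑ x, (if π ∣ x then F x else 0) = ∑ y, F (π * y) := by
  rw [← Finset.sum_fiberwise Finset.univ (fun y => π * y) (fun y => F (π * y)), Finset.mul_sum]
  refine Finset.sum_congr rfl fun x _ => ?_
  split_ifs with hx
  · obtain ⟨y0, rfl⟩ := hx
    have hc : (Finset.univ.filter (fun y : R => π * y = π * y0)).card = N := by
      rw [← h.cardAnn]
      refine Finset.card_bij (fun y _ => y - y0) ?_ ?_ ?_
      · intro y hy
        simp only [Finset.mem_filter, Finset.mem_univ, true_and] at hy ⊢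
        rw [mul_sub, hy, sub_self]
      · intro a _ b _ hab
        exact sub_left_injective hab
      · intro b hb
        simp only [Finset.mem_filter, Finset.mem_univ, true_and] at hb
        exact ⟨b + y0, by simp [mul_add, hb], by simp⟩
    rw [← hc, ← nsmul_eq_mul, ← Finset.sum_const]
    refine Finset.sum_congr rfl fun z hz => ?_
    rw [(Finset.mem_filter.1 hz).2]
  · rw [mul_zero]
    symm
    apply Finset.sum_eq_zero
    intro y hy
    exact absurd ⟨y, (Finset.mem_filter.1 hy).2.symm⟩ hx

lemma sum_units (f : R → ℂ) (hf : ∀ x, ¬ IsUnit x → f x = 0) :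
    ∑ x, f x = ∑ u : Rˣ, f u := by
  symm
  rw [← Finset.sum_filter_of_ne (s := Finset.univ) (f := f) (p := fun x => IsUnit x)
    (fun x _ hx => by by_contra hc; exact hx (hf x hc))]
  refine Finset.sum_bij (fun u _ => (u : R)) ?_ ?_ ?_ ?_
  · intro u _; simp
  · intro a _ b _ hab; exact Units.ext hab
  · intro b hb
    obtain ⟨u, hu⟩ := (Finset.mem_filter.1 hb).2
    exact ⟨u, Finset.mem_univ _, hu⟩
  · intro u _; rfl

lemma bilinear (h : LR π k N ψ) (M : ℕ) : ∀ (i : ℕ), i + M = k → ∀ a h1 h2 : R, IsUnit a →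
    ∑ X, ∑ Y, ψ (π ^ i * (a * X * Y + π * h1 * X ^ 3 + π * h2 * Y ^ 3)) = (N : ℂ) ^ (k + i) := by
  induction M using Nat.twoStepInduction with
  | zero =>
    intro i hi a h1 h2 _
    obtain rfl : i = k := by omega
    simp [h.pik, h.card, pow_add]
  | one =>
    intro i hi a h1 h2 ha
    have hpi : π ^ i * π = 0 := by rw [← pow_succ]; exact h.pi_ge (by omega)
    have e : ∀ X, ∑ Y, ψ (π ^ i * (a * X * Y + π * h1 * X ^ 3 + π * h2 * Y ^ 3)) =
        if π ∣ X then (N : ℂ) ^ k else 0 := by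
      intro X
      have : ∀ Y, π ^ i * (a * X * Y + π * h1 * X ^ 3 + π * h2 * Y ^ 3) =
          (π ^ i * (a * X)) * Y := by
        intro Y; linear_combination (h1 * X ^ 3 + h2 * Y ^ 3) * hpi
      simp only [this]
      rw [h.sum_ortho]
      have h2 : π ^ i * (a * X) = 0 ↔ π ∣ X := by
        rw [show i = k - 1 by omega, h.dvd_iff, h.dvd_mul_unit ha]
      simp only [h2]
    simp only [e]
    have := h.sum_dvd (fun _ => (N : ℂ) ^ k)
    apply mul_left_cancel₀ h.NC
    rw [this]
    simp only [Finset.sum_const, Finset.card_univ, h.card, nsmul_eq_mul, Nat.cast_pow]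
    rw [← pow_add, ← pow_succ']
    congr 1; omega
  | more M ih _ =>
    intro i hi a h1 h2 ha
    set f : R → R → ℂ := fun X Y => ψ (π ^ i * (a * X * Y + π * h1 * X ^ 3 + π * h2 * Y ^ 3))
      with hf
    have hz : π ^ i * (π * π ^ (k - i - 1)) = 0 := by
      rw [← pow_succ', ← pow_add]; exact h.pi_ge (by omega)
    have hz2 : π ^ i * π ^ (k - i - 1) = π ^ (k - 1) := by
      rw [← pow_add]; congr 1; omega
    have s2 : ∀ Y, ∑ X, f X Y = if π ∣ Y then ∑ X, f X Y else 0 := by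
      intro Y
      have := h.restrict (fun X => f X Y) (π ^ (k - i - 1)) (fun _ => π ^ (k - 1) * (a * Y)) (by
        intro X t
        simp only [hf]
        rw [← AddChar.map_add_eq_mul]
        congr 1
        linear_combination (a * Y * t) * hz2 +
          (h1 * (3 * X ^ 2 * t + 3 * X * t ^ 2 * π ^ (k - i - 1) +
            t ^ 3 * (π ^ (k - i - 1)) ^ 2)) * hz)
      rw [this]
      simp only [h.dvd_iff, h.dvd_mul_unit ha]
      split_ifs <;> simp
    have s5 : ∑ X, ∑ Y, f X Y = ∑ X, ∑ Y, if π ∣ X ∧ π ∣ Y then f X Y else 0 := by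
      have e1 : ∑ X, ∑ Y, f X Y = ∑ Y, if π ∣ Y then ∑ X, f X Y else 0 := by
        rw [Finset.sum_comm]; exact Finset.sum_congr rfl fun Y _ => s2 Y
      have e2 : ∀ X, (∑ Y, if π ∣ Y then f X Y else 0) =
          if π ∣ X then ∑ Y, (if π ∣ Y then f X Y else 0) else 0 := by
        intro X
        have := h.restrict (fun Y => if π ∣ Y then f X Y else 0) (π ^ (k - i - 1))
          (fun _ => π ^ (k - 1) * (a * X)) (by
          intro Y t
          have hd : π ∣ π ^ (k - i - 1) * t := by
            apply Dvd.dvd.mul_right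
            exact dvd_pow_self _ (by omega)
          simp only [hf, dvd_add_left hd]
          split_ifs
          · rw [← AddChar.map_add_eq_mul]
            congr 1
            linear_combination (a * X * t) * hz2 +
              (h2 * (3 * Y ^ 2 * t + 3 * Y * t ^ 2 * π ^ (k - i - 1) +
                t ^ 3 * (π ^ (k - i - 1)) ^ 2)) * hz
          · simp)
        rw [this]
        simp only [h.dvd_iff, h.dvd_mul_unit ha]
        by_cases hX : π ∣ X <;> simp [hX]
      rw [e1]
      have e3 : (∑ Y, if π ∣ Y then ∑ X, f X Y else 0) =
          ∑ X, ∑ Y, if π ∣ Y then f X Y else 0 := by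
        rw [Finset.sum_comm]
        refine Finset.sum_congr rfl fun Y _ => ?_
        split_ifs <;> simp
      rw [e3]
      refine Finset.sum_congr rfl fun X _ => ?_
      rw [e2]
      by_cases hX : π ∣ X <;> simp [hX]
    have s6 : (N : ℂ) ^ 2 * ∑ X, ∑ Y, f X Y = ∑ X, ∑ Y, f (π * X) (π * Y) := by
      rw [s5]
      have : (∑ X, ∑ Y, if π ∣ X ∧ π ∣ Y then f X Y else 0) =
          ∑ X, if π ∣ X then (∑ Y, if π ∣ Y then f X Y else 0) else 0 := by
        refine Finset.sum_congr rfl fun X _ => ?_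
        by_cases hX : π ∣ X <;> simp [hX]
      rw [this, pow_two, mul_assoc, h.sum_dvd (fun X => (∑ Y, if π ∣ Y then f X Y else 0)),
        Finset.mul_sum]
      exact Finset.sum_congr rfl fun X _ => h.sum_dvd (fun Y => f (π * X) Y)
    apply mul_left_cancel₀ (pow_ne_zero 2 h.NC)
    rw [s6]
    have := ih (i + 2) (by omega) a (π * h1) (π * h2) ha
    rw [← pow_add, show 2 + (k + i) = k + (i + 2) by ring, ← this]
    refine Finset.sum_congr rfl fun X _ => Finset.sum_congr rfl fun Y _ => ?_
    simp only [hf]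
    congr 1; ring

end LR

end RingPart


section RingPart2

variable {R : Type} [CommRing R] [Fintype R] {π : R} {k N : ℕ} {ψ : AddChar R ℂ}

/-- The sum in an abstract ring. -/
def SR (π : R) (ψ : AddChar R ℂ) (χ : MulChar R ℂ) (w B : R) (j : ℕ) : ℂ :=
  ∑ A, χ A * ∑ x, ψ (π ^ 3 * Ring.inverse (w * A) + A * w ^ 2 * x ^ 3 + π ^ j * B * x)

namespace LR

lemma inv_shift (w A s : R) (h1 : IsUnit (w * A)) (h2 : IsUnit (w * (A + s))) :
    Ring.inverse (w * (A + s)) = Ring.inverse (w * A) -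
      Ring.inverse (w * A) * Ring.inverse (w * (A + s)) * w * s := by
  have e1 := Ring.mul_inverse_cancel _ h1
  have e2 := Ring.mul_inverse_cancel _ h2
  linear_combination -Ring.inverse (w * (A + s)) * e1 + Ring.inverse (w * A) * e2

lemma step_one (h : LR π k N ψ) (hk : 2 ≤ k) (χ : MulChar R ℂ) (hχ : ∀ A t, χ (A + π * t) = χ A)
    (w B : R) (hw : IsUnit w) (j : ℕ) :
    (N : ℂ) * SR π ψ χ w B j =
      ∑ A, χ A * ∑ y, ψ (π ^ 3 * (Ring.inverse (w * A) + A * w ^ 2 * y ^ 3) +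
        π ^ (j + 1) * B * y) := by
  obtain ⟨e, he1, he2, he3⟩ : ∃ e, 1 ≤ e ∧ k ≤ 3 + e ∧ e + 1 ≤ k := by
    refine ⟨max 1 (k - 3), ?_, ?_, ?_⟩ <;> omega
  have hz : π ^ 3 * π ^ e = 0 := by rw [← pow_add]; exact h.pi_ge he2
  set f : R → R → ℂ := fun A x =>
    χ A * ψ (π ^ 3 * Ring.inverse (w * A) + A * w ^ 2 * x ^ 3 + π ^ j * B * x) with hf
  have s1 : ∀ x, ∑ A, f A x = if π ∣ x then ∑ A, f A x else 0 := by
    intro x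
    split_ifs with hx
    · rfl
    rw [h.restrict (fun A => f A x) (π ^ e) (fun _ => π ^ e * (w ^ 2 * x ^ 3))]
    · have : π ^ e * (w ^ 2 * x ^ 3) ≠ 0 := by
        intro h0
        rw [h.ann e (by omega), (hw.pow 2).dvd_mul_left] at h0
        exact hx (h.dvd_of_pow 3 ((dvd_pow_self π (by omega)).trans h0))
      simp [this]
    · intro A t
      have hd : π ^ e * t = π * (π ^ (e - 1) * t) := by
        rw [← mul_assoc, ← pow_succ']; congr 2; omega
      by_cases hA : IsUnit A
      · simp only [hf]
        rw [mul_assoc (_ : ℂ), ← AddChar.map_add_eq_mul]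
        congr 1
        · rw [hd, hχ]
        · congr 1
          have hA' : IsUnit (A + π ^ e * t) := h.unit_add hA (hd ▸ dvd_mul_right _ _)
          rw [inv_shift w A _ (hw.mul hA) (hw.mul hA')]
          linear_combination (-(Ring.inverse (w * A) * Ring.inverse (w * (A + π ^ e * t)) * w * t)) * hz
      · simp only [hf]
        rw [hd, hχ, MulChar.map_nonunit χ hA]; simp
  have s2 : SR π ψ χ w B j = ∑ x, if π ∣ x then ∑ A, f A x else 0 := by
    unfold SR
    simp only [Finset.mul_sum]
    rw [Finset.sum_comm]
    exact Finset.sum_congr rfl fun x _ => s1 x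
  rw [s2, h.sum_dvd (fun x => ∑ A, f A x), Finset.sum_comm]
  refine Finset.sum_congr rfl fun A _ => ?_
  rw [Finset.mul_sum]
  refine Finset.sum_congr rfl fun y _ => ?_
  simp only [hf]
  congr 2; ring

lemma case_two (h : LR π k N ψ) (hk : k = 2) (χ : MulChar R ℂ) (hχ : ∀ A t, χ (A + π * t) = χ A)
    (hχ1 : χ ≠ 1) (w B : R) (hw : IsUnit w) (j : ℕ) (hj : 1 ≤ j) : SR π ψ χ w B j = 0 := by
  apply mul_left_cancel₀ h.NC
  rw [h.step_one (by omega) χ hχ w B hw j, h.pi_ge (m := 3) (by omega),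
    h.pi_ge (m := j + 1) (by omega)]
  simp only [zero_mul, add_zero, AddChar.map_zero_eq_one]
  rw [← Finset.sum_mul, MulChar.sum_eq_zero_of_ne_one hχ1]; simp

lemma case_three (h : LR π k N ψ) (hk : k = 3) (w B : R) (hw : IsUnit w) (j : ℕ) (hj : 2 ≤ j) :
    SR π ψ 1 w B j = (Fintype.card Rˣ : ℂ) * (N : ℂ) ^ 2 := by
  apply mul_left_cancel₀ h.NC
  rw [h.step_one (by omega) 1 _ w B hw j, h.pi_ge (m := 3) (by omega),
    h.pi_ge (m := j + 1) (by omega)]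
  · simp only [zero_mul, add_zero, AddChar.map_zero_eq_one]
    rw [← Finset.sum_mul, MulChar.sum_one_eq_card_units]
    simp [h.card, hk]; ring
  · intro A t
    by_cases hA : IsUnit A
    · rw [MulChar.one_apply hA, MulChar.one_apply (h.unit_add hA (dvd_mul_right _ _))]
    · rw [MulChar.map_nonunit _ hA, MulChar.map_nonunit]
      intro h'
      apply hA
      have := h.unit_add h' (y := - (π * t)) (by simp)
      simpa using this

lemma case_j_one (h : LR π k N ψ) (hk : 3 ≤ k) (χ : MulChar R ℂ) (hχ : ∀ A t, χ (A + π * t) = χ A)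
    (w B : R) (hw : IsUnit w) (hB : IsUnit B) : SR π ψ χ w B 1 = 0 := by
  apply mul_left_cancel₀ h.NC
  rw [h.step_one (by omega) χ hχ w B hw 1, mul_zero]
  apply Finset.sum_eq_zero
  intro A _
  have hz : π ^ 3 * π ^ (k - 3) = 0 := by rw [← pow_add]; exact h.pi_ge (by omega)
  have hz2 : π ^ 2 * π ^ (k - 3) = π ^ (k - 1) := by rw [← pow_add]; congr 1; omega
  rw [h.restrict _ (π ^ (k - 3)) (fun _ => π ^ (k - 1) * B)]
  · have : π ^ (k - 1) * B ≠ 0 := by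
      rw [Ne, h.dvd_iff]; exact h.not_dvd_of_unit hB
    simp [this]
  · intro y t
    rw [← AddChar.map_add_eq_mul]
    congr 1
    linear_combination B * t * hz2 + (A * w ^ 2 * (3 * y ^ 2 * t + 3 * y * t ^ 2 * π ^ (k - 3) +
      t ^ 3 * (π ^ (k - 3)) ^ 2)) * hz

lemma chi_pi (χ : MulChar R ℂ) (hχ : ∀ A t, χ (A + π * t) = χ A) {x y : R}
    (hd : π ∣ y - x) : χ y = χ x := by
  obtain ⟨t, ht⟩ := hd
  rw [show y = x + π * t by linear_combination ht, hχ]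

lemma step_two (h : LR π k N ψ) (hk : 5 ≤ k) (χ : MulChar R ℂ) (hχ : ∀ A t, χ (A + π * t) = χ A)
    (hχ3 : χ ^ 3 = 1)
    (w b : R) (hw : IsUnit w) :
    ∑ A, χ A * ∑ y, ψ (π ^ 3 * (Ring.inverse (w * A) + A * w ^ 2 * y ^ 3 + b * y)) =
    ∑ u, ∑ v, χ (v ^ 2 * u) ^ 2 * ψ (π ^ 3 * (Ring.inverse w * (u * v * (u + v + b)))) := by
  set f : R → R → ℂ := fun A y =>
    χ A * ψ (π ^ 3 * (Ring.inverse (w * A) + A * w ^ 2 * y ^ 3 + b * y)) with hf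
  have hz : π ^ 3 * (π ^ (k - 4)) ^ 2 = 0 := by
    rw [← pow_mul, ← pow_add]; exact h.pi_ge (by omega)
  have hz2 : π ^ 3 * π ^ (k - 4) = π ^ (k - 1) := by rw [← pow_add]; congr 1; omega
  have s1 : ∀ y, ¬ IsUnit y → ∑ A, f A y = 0 := by
    intro y hy
    have hy' : π ∣ y := (h.unit_or y).resolve_left hy
    rw [h.restrict (fun A => f A y) (π ^ (k - 4))
      (fun A => π ^ (k - 1) * (w ^ 2 * y ^ 3 - w * Ring.inverse (w * A) ^ 2))]
    · apply Finset.sum_eq_zero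
      intro A _
      split_ifs with h0
      · rw [h.dvd_iff] at h0
        by_cases hA : IsUnit A
        · exfalso
          have h1 : π ∣ w * Ring.inverse (w * A) ^ 2 := by
            have : π ∣ w ^ 2 * y ^ 3 := Dvd.dvd.mul_left (dvd_pow hy' (by omega)) _
            exact (dvd_sub_right this).1 h0
          refine h.not_dvd_of_unit (hw.mul (IsUnit.pow 2 ?_)) h1
          exact (hw.mul hA).ringInverse
        · simp only [hf]; rw [MulChar.map_nonunit χ hA, zero_mul]
      · rfl
    · intro A t
      have hd : π ^ (k - 4) * t = π * (π ^ (k - 4 - 1) * t) := by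
        rw [← mul_assoc, ← pow_succ']; congr 2; omega
      by_cases hA : IsUnit A
      · simp only [hf]
        rw [mul_assoc (_ : ℂ), ← AddChar.map_add_eq_mul]
        congr 1
        · rw [hd, hχ]
        · congr 1
          have hA' : IsUnit (A + π ^ (k - 4) * t) := h.unit_add hA (hd ▸ dvd_mul_right _ _)
          have e := inv_shift w A _ (hw.mul hA) (hw.mul hA')
          set I := Ring.inverse (w * A)
          set J := Ring.inverse (w * (A + π ^ (k - 4) * t))
          linear_combination (π ^ 3 - π ^ 3 * I * w * (π ^ (k - 4) * t)) * e +
            (I ^ 2 * J * w ^ 2 * t ^ 2) * hz +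
            (t * (w ^ 2 * y ^ 3 - w * I ^ 2)) * hz2
      · simp only [hf]
        rw [hd, hχ, MulChar.map_nonunit χ hA]; simp
  have hunit : ∀ y, ∑ A, f A y = ∑ A : Rˣ, f A y := by
    intro y
    apply sum_units (fun A => f A y)
    intro A hA
    simp only [hf]; rw [MulChar.map_nonunit χ hA, zero_mul]
  obtain ⟨w, rfl⟩ := hw
  have hchi3 : ∀ u : Rˣ, χ (u : R) ^ 3 = 1 := by
    intro u
    rw [← MulChar.pow_apply' χ three_ne_zero, hχ3, MulChar.one_apply u.isUnit]
  calc _ = ∑ y, ∑ A, f A y := by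
        simp only [Finset.mul_sum]; rw [Finset.sum_comm]
    _ = ∑ y : Rˣ, ∑ A : Rˣ, f A y := by
        rw [sum_units (fun y => ∑ A, f A y) s1]
        exact Finset.sum_congr rfl fun y _ => hunit y
    _ = ∑ y : Rˣ, ∑ v : Rˣ, f ((w * y * v)⁻¹ : Rˣ) y := by
        refine Finset.sum_congr rfl fun y _ => ?_
        rw [← Equiv.sum_comp ((Equiv.mulLeft (w * y)).trans (Equiv.inv Rˣ))]
        rfl
    _ = ∑ v : Rˣ, ∑ u : Rˣ, f ((w * (w⁻¹ * v * u) * v)⁻¹ : Rˣ) (w⁻¹ * v * u : Rˣ) := by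
        rw [Finset.sum_comm]
        refine Finset.sum_congr rfl fun v _ => ?_
        rw [← Equiv.sum_comp (Equiv.mulLeft (w⁻¹ * v))]
        rfl
    _ = ∑ v : Rˣ, ∑ u : Rˣ, χ ((v : R) ^ 2 * u) ^ 2 *
          ψ (π ^ 3 * (Ring.inverse (w : R) * (u * v * (u + v + b)))) := by
        refine Finset.sum_congr rfl fun v _ => Finset.sum_congr rfl fun u _ => ?_
        have e1 : w * (w⁻¹ * v * u) * v = v ^ 2 * u := by
          rw [mul_assoc w⁻¹, mul_inv_cancel_left, pow_two]; ac_rfl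
        simp only [hf]
        rw [e1]
        congr 1
        · have h1 : χ (((v ^ 2 * u)⁻¹ : Rˣ) : R) * χ ((v ^ 2 * u : Rˣ) : R) = 1 := by
            rw [← map_mul, Units.inv_mul, map_one]
          have h2 := hchi3 (v ^ 2 * u)
          have h4 : ((v ^ 2 * u : Rˣ) : R) = (v : R) ^ 2 * u := by simp
          rw [h4] at h1 h2
          linear_combination (χ ((v : R) ^ 2 * u)) ^ 2 * h1 - χ (((v ^ 2 * u)⁻¹ : Rˣ) : R) * h2
        · congr 1
          rw [Ring.inverse_unit]
          have e2 : Ring.inverse ((w : R) * ((v ^ 2 * u)⁻¹ : Rˣ)) = (w⁻¹ : Rˣ) * (v ^ 2 * u : Rˣ) := by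
            rw [← Units.val_mul, Ring.inverse_unit, ← Units.val_mul]
            congr 1; rw [mul_inv, inv_inv]
          rw [e2]
          have e3 : (((v ^ 2 * u)⁻¹ : Rˣ) : R) * ((v : R) ^ 2 * u) = 1 := by
            have := Units.inv_mul (v ^ 2 * u)
            simpa using this
          have e4 : (w : R) * (w⁻¹ : Rˣ) = 1 := Units.mul_inv w
          push_cast
          set W := ((w⁻¹ : Rˣ) : R)
          generalize (((v ^ 2 * u)⁻¹ : Rˣ) : R) = Q at e3 ⊢
          generalize (v : R) = V at e3 ⊢
          generalize (u : R) = U at e3 ⊢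
          generalize (w : R) = w' at e4 ⊢
          linear_combination π ^ 3 * (V * U ^ 2 * w' ^ 2 * W ^ 3) * e3 +
            π ^ 3 * (V * U ^ 2 * W) * (w' * W + 1) * e4
    _ = _ := by
        rw [Finset.sum_comm]
        rw [sum_units (R := R)]
        · refine Finset.sum_congr rfl fun u _ => ?_
          rw [sum_units (R := R)]
          intro v hv
          rw [map_mul, map_pow, MulChar.map_nonunit χ hv]; simp
        · intro u hu
          apply Finset.sum_eq_zero
          intro v _
          rw [map_mul, MulChar.map_nonunit χ hu]; simp

lemma step_three (h : LR π k N ψ) (hk : 5 ≤ k) (χ : MulChar R ℂ)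
    (hχ : ∀ A t, χ (A + π * t) = χ A)
    (W b : R) (hW : IsUnit W) :
    ∑ u, ∑ v, χ (v ^ 2 * u) ^ 2 * ψ (π ^ 3 * (W * (u * v * (u + v + b)))) =
    ∑ u, ∑ v, if π ∣ 2 * u + v + b ∧ π ∣ u + 2 * v + b then
      χ (v ^ 2 * u) ^ 2 * ψ (π ^ 3 * (W * (u * v * (u + v + b)))) else 0 := by
  set f : R → R → ℂ := fun u v =>
    χ (v ^ 2 * u) ^ 2 * ψ (π ^ 3 * (W * (u * v * (u + v + b)))) with hf
  have hz : π ^ 3 * (π ^ (k - 4)) ^ 2 = 0 := by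
    rw [← pow_mul, ← pow_add]; exact h.pi_ge (by omega)
  have hz2 : π ^ 3 * π ^ (k - 4) = π ^ (k - 1) := by rw [← pow_add]; congr 1; omega
  have hp : ∀ t, π ∣ π ^ (k - 4) * t := fun t =>
    Dvd.dvd.mul_right (dvd_pow_self _ (by omega)) _
  have shu : ∀ u v t, f (u + π ^ (k - 4) * t) v =
      f u v * ψ (π ^ (k - 1) * (W * v * (2 * u + v + b)) * t) := by
    intro u v t
    simp only [hf]
    rw [mul_assoc (_ : ℂ), ← AddChar.map_add_eq_mul]
    congr 1
    · congr 1
      apply chi_pi χ hχ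
      rw [show v ^ 2 * (u + π ^ (k - 4) * t) - v ^ 2 * u = π ^ (k - 4) * (t * v ^ 2) by ring]
      exact hp _
    · congr 1
      linear_combination (W * v * (2 * u + v + b) * t) * hz2 + W * v * t ^ 2 * hz
  have shv : ∀ u v t, f u (v + π ^ (k - 4) * t) =
      f u v * ψ (π ^ (k - 1) * (W * u * (u + 2 * v + b)) * t) := by
    intro u v t
    simp only [hf]
    rw [mul_assoc (_ : ℂ), ← AddChar.map_add_eq_mul]
    congr 1
    · congr 1
      apply chi_pi χ hχ
      rw [show (v + π ^ (k - 4) * t) ^ 2 * u - v ^ 2 * u =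
        π ^ (k - 4) * (t * u * (2 * v + π ^ (k - 4) * t)) by ring]
      exact hp _
    · congr 1
      linear_combination (W * u * (u + 2 * v + b) * t) * hz2 + W * u * t ^ 2 * hz
  have hfu : ∀ u v, ¬ IsUnit u → f u v = 0 := by
    intro u v hu
    simp only [hf]; rw [map_mul, MulChar.map_nonunit χ hu]; simp
  have hfv : ∀ u v, ¬ IsUnit v → f u v = 0 := by
    intro u v hv
    simp only [hf]; rw [map_mul, map_pow, MulChar.map_nonunit χ hv]; simp
  have s1 : ∀ v, ∑ u, f u v = ∑ u, if π ∣ 2 * u + v + b then f u v else 0 := by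
    intro v
    rw [h.restrict (fun u => f u v) _ _ (fun u t => shu u v t)]
    refine Finset.sum_congr rfl fun u _ => ?_
    by_cases hv : IsUnit v
    · simp only [h.dvd_iff, h.dvd_mul_unit (hW.mul hv)]
    · simp only [hfv u v hv]; simp
  have s2 : ∀ u, (∑ v, if π ∣ 2 * u + v + b then f u v else 0) =
      ∑ v, if π ∣ 2 * u + v + b ∧ π ∣ u + 2 * v + b then f u v else 0 := by
    intro u
    rw [h.restrict (fun v => if π ∣ 2 * u + v + b then f u v else 0) (π ^ (k - 4))
      (fun v => π ^ (k - 1) * (W * u * (u + 2 * v + b)))]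
    · refine Finset.sum_congr rfl fun v _ => ?_
      by_cases hu : IsUnit u
      · simp only [h.dvd_iff, h.dvd_mul_unit (hW.mul hu)]
        by_cases h1 : π ∣ 2 * u + v + b <;> simp [h1]
      · simp only [hfu u v hu]; simp
    · intro v t
      have : π ∣ 2 * u + (v + π ^ (k - 4) * t) + b ↔ π ∣ 2 * u + v + b := by
        rw [show 2 * u + (v + π ^ (k - 4) * t) + b = (2 * u + v + b) + π ^ (k - 4) * t by ring]
        exact dvd_add_left (hp t)
      simp only [this, shv]
      split_ifs
      · rfl
      · simp
  rw [Finset.sum_comm, Finset.sum_congr rfl fun v _ => s1 v, Finset.sum_comm]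
  exact Finset.sum_congr rfl fun u _ => s2 u

lemma case_zero (h : LR π k N ψ) (hk : 5 ≤ k) (χ : MulChar R ℂ) (hχ : ∀ A t, χ (A + π * t) = χ A)
    (hχ3 : χ ^ 3 = 1) (h3 : IsUnit (3 : R))
    (w B : R) (hw : IsUnit w) (j : ℕ) (hj : 3 ≤ j) : SR π ψ χ w B j = 0 := by
  apply mul_left_cancel₀ h.NC
  rw [h.step_one (by omega) χ hχ w B hw j, mul_zero]
  have e : ∀ A y : R, π ^ 3 * (Ring.inverse (w * A) + A * w ^ 2 * y ^ 3) + π ^ (j + 1) * B * y =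
      π ^ 3 * (Ring.inverse (w * A) + A * w ^ 2 * y ^ 3 + (π ^ (j - 2) * B) * y) := by
    intro A y
    rw [show j + 1 = 3 + (j - 2) by omega, pow_add]; ring
  simp only [e]
  rw [h.step_two hk χ hχ hχ3 w _ hw, h.step_three hk χ hχ _ _ hw.ringInverse]
  have hb : π ∣ π ^ (j - 2) * B := Dvd.dvd.mul_right (dvd_pow_self _ (by omega)) _
  apply Finset.sum_eq_zero
  intro u _
  apply Finset.sum_eq_zero
  intro v _
  split_ifs with hc
  · obtain ⟨h1, h2⟩ := hc
    have : π ∣ 3 * u := by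
      have := dvd_sub (dvd_sub (Dvd.dvd.mul_left h1 2) h2) hb
      convert this using 1; ring
    rw [h.dvd_mul_unit h3] at this
    rw [map_mul, MulChar.map_nonunit χ (fun hu => h.not_dvd_of_unit hu this)]
    simp
  · rfl

lemma case_main (h : LR π k N ψ) (hk : 5 ≤ k) (χ : MulChar R ℂ) (hχ : ∀ A t, χ (A + π * t) = χ A)
    (hχ3 : χ ^ 3 = 1) (h3 : IsUnit (3 : R)) (ζ : R) (hζ : ζ ^ 2 + ζ + 1 = 0)
    (w B : R) (hw : IsUnit w) (hB : IsUnit B) :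
    SR π ψ χ w B 2 = (N : ℂ) ^ (k + 2) * ψ (π ^ 3 * (B ^ 3 * Ring.inverse (3 ^ 3 * w))) := by
  apply mul_left_cancel₀ (pow_ne_zero 3 h.NC)
  rw [show (N : ℂ) ^ 3 * SR π ψ χ w B 2 = N ^ 2 * (N * SR π ψ χ w B 2) by ring]
  rw [h.step_one (by omega) χ hχ w B hw 2]
  have e : ∀ A y : R, π ^ 3 * (Ring.inverse (w * A) + A * w ^ 2 * y ^ 3) + π ^ (2 + 1) * B * y =
      π ^ 3 * (Ring.inverse (w * A) + A * w ^ 2 * y ^ 3 + B * y) := by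
    intro A y; ring
  simp only [e]
  rw [h.step_two hk χ hχ hχ3 w _ hw, h.step_three hk χ hχ _ _ hw.ringInverse]
  obtain ⟨i3, hi3⟩ := h3.exists_right_inv
  have hW1 : w * Ring.inverse w = 1 := Ring.mul_inverse_cancel _ hw
  have hinv : Ring.inverse (3 ^ 3 * w) = i3 ^ 3 * Ring.inverse w := by
    have h27 : IsUnit (3 ^ 3 * w) := (h3.pow 3).mul hw
    have e1 := Ring.mul_inverse_cancel _ h27
    have hc : i3 ^ 3 * Ring.inverse w * (3 ^ 3 * w) = 1 := by
      have : (3 * i3) ^ 3 * (w * Ring.inverse w) = 1 := by rw [hi3, hW1]; ring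
      linear_combination this
    linear_combination (-Ring.inverse (3 ^ 3 * w)) * hc + i3 ^ 3 * Ring.inverse w * e1
  have hWu : IsUnit (Ring.inverse w) := hw.ringInverse
  have hi3u : IsUnit i3 := IsUnit.of_mul_eq_one 3 (by rw [mul_comm]; exact hi3)
  rw [hinv]
  set W := Ring.inverse w
  set c := B * i3 with hc
  have hbc : B = 3 * c := by rw [hc]; linear_combination (-B) * hi3
  have hcu : IsUnit c := hB.mul hi3u
  have hcond : ∀ u v, (π ∣ 2 * u + v + B ∧ π ∣ u + 2 * v + B) ↔ (π ∣ u + c ∧ π ∣ v + c) := by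
    intro u v
    constructor
    · rintro ⟨h1, h2⟩
      constructor
      · rw [← h.dvd_mul_unit h3]
        have := dvd_sub (Dvd.dvd.mul_left h1 2) h2
        convert this using 1; rw [hbc]; ring
      · rw [← h.dvd_mul_unit h3]
        have := dvd_sub (Dvd.dvd.mul_left h2 2) h1
        convert this using 1; rw [hbc]; ring
    · rintro ⟨h1, h2⟩
      constructor
      · have := dvd_add (Dvd.dvd.mul_left h1 2) h2
        convert this using 1; rw [hbc]; ring
      · have := dvd_add (Dvd.dvd.mul_left h2 2) h1
        convert this using 1; rw [hbc]; ring
  have t1 : (∑ u, ∑ v, if π ∣ 2 * u + v + B ∧ π ∣ u + 2 * v + B then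
      χ (v ^ 2 * u) ^ 2 * ψ (π ^ 3 * (W * (u * v * (u + v + B)))) else 0) =
      ∑ u, if π ∣ u then (∑ v, if π ∣ v then
        ψ (π ^ 3 * (W * ((u - c) * (v - c) * (u + v + c)))) else 0) else 0 := by
    rw [← Equiv.sum_comp (Equiv.subRight c)]
    refine Finset.sum_congr rfl fun u _ => ?_
    rw [← Equiv.sum_comp (Equiv.subRight c)]
    simp only [Equiv.subRight_apply, hcond, sub_add_cancel]
    by_cases hu : π ∣ u
    · simp only [hu, true_and, if_true]
      refine Finset.sum_congr rfl fun v _ => ?_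
      split_ifs with hv
      · have e1 : χ ((v - c) ^ 2 * (u - c)) = χ (-c) ^ 3 := by
          rw [map_mul, map_pow, chi_pi χ hχ (x := -c) (y := v - c) (by simpa using hv),
            chi_pi χ hχ (x := -c) (y := u - c) (by simpa using hu)]; ring
        rw [e1, ← MulChar.pow_apply' χ three_ne_zero, hχ3, MulChar.one_apply hcu.neg, one_pow,
          one_mul]
        congr 1; rw [hbc]; ring
      · rfl
    · simp [hu]
  rw [t1, pow_two, mul_assoc, h.sum_dvd (fun u => (∑ v, if π ∣ v then
        ψ (π ^ 3 * (W * ((u - c) * (v - c) * (u + v + c)))) else 0)), Finset.mul_sum]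
  rw [Finset.sum_congr rfl fun u _ => h.sum_dvd
    (fun v => ψ (π ^ 3 * (W * ((π * u - c) * (v - c) * (π * u + v + c)))))]
  -- linear change of variables
  set D := ζ - ζ ^ 2 with hD
  have hDD : D ^ 2 = -3 := by rw [hD]; linear_combination (ζ ^ 2 - 3 * ζ + 3) * hζ
  set Di := - D * i3 with hDi
  have hDDi : D * Di = 1 := by rw [hDi]; linear_combination (-i3) * hDD + hi3
  have hDiu : IsUnit Di := IsUnit.of_mul_eq_one D (by rw [mul_comm]; exact hDDi)
  have t2 : ∑ u, ∑ v, ψ (π ^ 3 * (W * ((π * u - c) * (π * v - c) * (π * u + π * v + c)))) =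
      ∑ X, ∑ Y, ψ (π ^ 3 * (W * ((π * (X + ζ * (Di * (Y - X))) - c) * (π * (Di * (Y - X)) - c) *
        (π * (X + ζ * (Di * (Y - X))) + π * (Di * (Y - X)) + c)))) := by
    rw [Finset.sum_comm]
    calc _ = ∑ v, ∑ X, ψ (π ^ 3 * (W * ((π * (X + ζ * v) - c) * (π * v - c) *
          (π * (X + ζ * v) + π * v + c)))) := by
          refine Finset.sum_congr rfl fun v _ => ?_
          rw [← Equiv.sum_comp (Equiv.addRight (ζ * v))]
          rfl
      _ = _ := by
          rw [Finset.sum_comm]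
          refine Finset.sum_congr rfl fun X _ => ?_
          rw [← Equiv.sum_comp ((Equiv.subRight X).trans hDiu.unit.mulLeft)]
          rfl
  rw [t2]
  have t3 := h.bilinear (k - 5) 5 (by omega) (-(W * c)) (W * D * i3 ^ 2) (-(W * D * i3 ^ 2))
    ((hWu.mul hcu).neg)
  have e2 : (N : ℂ) ^ 3 * ((N : ℂ) ^ (k + 2) * ψ (π ^ 3 * (B ^ 3 * (i3 ^ 3 * W)))) =
    ψ (π ^ 3 * (B ^ 3 * (i3 ^ 3 * W))) * (N : ℂ) ^ (k + 5) := by ring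
  rw [e2, ← t3]
  simp only [Finset.mul_sum]
  refine Finset.sum_congr rfl fun X _ => Finset.sum_congr rfl fun Y _ => ?_
  rw [← AddChar.map_add_eq_mul]
  congr 1
  have key1 : ∀ v : R, (X + ζ * v) ^ 2 + (X + ζ * v) * v + v ^ 2 = X * (X + D * v) := by
    intro v; rw [hD]; linear_combination (v ^ 2 + X * v) * hζ
  have hv : X + D * (Di * (Y - X)) = Y := by linear_combination (Y - X) * hDDi
  have key2 : (X + ζ * (Di * (Y - X))) * (Di * (Y - X)) * ((X + ζ * (Di * (Y - X))) +
      (Di * (Y - X))) = D * i3 ^ 2 * (X ^ 3 - Y ^ 3) := by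
    set v := Di * (Y - X)
    rw [← hv]
    have : (X + ζ * v) * v * ((X + ζ * v) + v) = X ^ 2 * v + D * X * v ^ 2 - v ^ 3 := by
      rw [hD]; linear_combination (v ^ 3 + X * v ^ 2) * hζ
    rw [this]
    have e5 : (3 * i3) ^ 2 = 1 := by rw [hi3]; ring
    have e6 : D * (X ^ 3 - (X + D * v) ^ 3) = 9 * (X ^ 2 * v + D * X * v ^ 2 - v ^ 3) := by
      linear_combination (-3 * X ^ 2 * v - 3 * X * v ^ 2 * D - v ^ 3 * (D ^ 2 - 3)) * hDD
    linear_combination (-i3 ^ 2) * e6 - (X ^ 2 * v + D * X * v ^ 2 - v ^ 3) * e5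
  have key1' := key1 (Di * (Y - X))
  rw [hv] at key1'
  set α := X + ζ * (Di * (Y - X))
  set β := Di * (Y - X)
  have hc3 : B ^ 3 * i3 ^ 3 = c ^ 3 := by rw [hc]; ring
  linear_combination (-π ^ 3 * W) * hc3 - π ^ 5 * W * c * key1' + π ^ 6 * W * key2

end LR

end RingPart2


section OKPart

lemma om_prim : IsPrimitiveRoot ω 3 := by
  have := Complex.isPrimitiveRoot_exp 3 (by norm_num)
  unfold ω
  simpa using this

lemma om_three : ω ^ 3 = 1 := om_prim.pow_eq_one

lemma om_ne_one : ω ≠ 1 := om_prim.ne_one (by norm_num)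

lemma om_quad : ω ^ 2 + ω + 1 = 0 := by
  have h : (ω - 1) * (ω ^ 2 + ω + 1) = 0 := by linear_combination om_three
  exact (mul_eq_zero.1 h).resolve_left (sub_ne_zero.2 om_ne_one)

lemma conj_om : (starRingEnd ℂ) ω = ω ^ 2 := by
  have h1 : ‖ω‖ = 1 := om_prim.norm'_eq_one (by norm_num)
  have h2 : (starRingEnd ℂ) ω * ω = 1 := by
    rw [Complex.conj_mul', h1]; simp
  linear_combination ω ^ 2 * h2 - (starRingEnd ℂ) ω * om_three

lemma delta_sq : δ ^ 2 = -3 := by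
  unfold δ; linear_combination (ω ^ 2 - 3 * ω + 3) * om_quad

lemma delta_ne : δ ≠ 0 := by
  intro h
  have := delta_sq
  rw [h] at this
  norm_num at this

lemma conj_delta : (starRingEnd ℂ) δ = -δ := by
  unfold δ; simp only [map_sub, map_pow, conj_om]
  linear_combination -ω * om_three

/-- `ω` as an element of the ring. -/
def om : OK := ⟨ω, Subring.subset_closure rfl⟩

lemma om_quad' : om ^ 2 + om + 1 = 0 := Subtype.ext om_quad

lemma OK_form (x : OK) : ∃ a b : ℤ, x = a + b * om := by
  obtain ⟨x, hx⟩ := x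
  have : ∃ a b : ℤ, x = a + b * ω := by
    unfold O at hx
    induction hx using Subring.closure_induction with
    | mem x h => exact ⟨0, 1, by rw [Set.mem_singleton_iff.1 h]; simp⟩
    | zero => exact ⟨0, 0, by simp⟩
    | one => exact ⟨1, 0, by simp⟩
    | add x y _ _ hx hy =>
      obtain ⟨a, b, rfl⟩ := hx
      obtain ⟨c, d, rfl⟩ := hy
      exact ⟨a + c, b + d, by push_cast; ring⟩
    | neg x _ hx =>
      obtain ⟨a, b, rfl⟩ := hx
      exact ⟨-a, -b, by push_cast; ring⟩
    | mul x y _ _ hx hy =>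
      obtain ⟨a, b, rfl⟩ := hx
      obtain ⟨c, d, rfl⟩ := hy
      refine ⟨a * c - b * d, a * d + b * c - b * d, ?_⟩
      push_cast
      linear_combination (b * d : ℂ) * om_quad
  obtain ⟨a, b, h⟩ := this
  refine ⟨a, b, Subtype.ext ?_⟩
  change x = _
  rw [h]; simp [om]

lemma eC_add (x y : ℂ) : eC (x + y) = eC x * eC y := by
  unfold eC
  rw [← Complex.exp_add]
  congr 1
  rw [add_div, map_add]; ring

lemma eC_zero : eC 0 = 1 := by simp [eC]

lemma eC_eq_one (z : ℂ) : eC z = 1 ↔ ∃ n : ℤ, z - (starRingEnd ℂ) z = n * δ := by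
  unfold eC
  rw [Complex.exp_eq_one_iff]
  have h2 : (2 * Real.pi * Complex.I : ℂ) ≠ 0 := by
    simp [Real.pi_ne_zero]
  have h3 : z / δ + (starRingEnd ℂ) (z / δ) = (z - (starRingEnd ℂ) z) / δ := by
    rw [map_div₀, conj_delta]; field_simp [delta_ne]; ring
  constructor
  · rintro ⟨n, hn⟩
    refine ⟨n, ?_⟩
    have h4 : z / δ + (starRingEnd ℂ) (z / δ) = n := by
      apply mul_left_cancel₀ h2
      rw [hn]; ring
    rw [h3, div_eq_iff delta_ne] at h4
    exact h4
  · rintro ⟨n, hn⟩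
    refine ⟨n, ?_⟩
    rw [h3, hn, mul_div_cancel_right₀ _ delta_ne]; ring

lemma eC_int (x : OK) : eC (x : ℂ) = 1 := by
  rw [eC_eq_one]
  obtain ⟨a, b, rfl⟩ := OK_form x
  refine ⟨b, ?_⟩
  simp only [om, δ]
  push_cast
  simp only [map_add, map_mul, map_intCast, conj_om]
  ring

lemma eC_nondeg (z : ℂ) (h1 : eC z = 1) (h2 : eC (z * ω) = 1) : ∃ x : OK, (x : ℂ) = z := by
  rw [eC_eq_one] at h1 h2
  obtain ⟨n, hn⟩ := h1
  obtain ⟨m, hm⟩ := h2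
  rw [map_mul, conj_om] at hm
  refine ⟨(m : OK) - om ^ 2 * (n : OK), ?_⟩
  push_cast
  simp only [om]
  apply mul_right_cancel₀ delta_ne
  have : z * δ = z * ω - z * ω ^ 2 := by unfold δ; ring
  rw [this]
  linear_combination (-1 : ℂ) * hm + ω ^ 2 * hn

lemma rep_mk {I : Ideal OK} (x : OK ⧸ I) : Ideal.Quotient.mk I (rep x) = x :=
  Function.surjInv_eq Ideal.Quotient.mk_surjective x

lemma mk_eq_iff (c x y : OK) : Ideal.Quotient.mk (Ideal.span {c}) x = Ideal.Quotient.mk _ y ↔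
    c ∣ x - y := by
  rw [Ideal.Quotient.eq, Ideal.mem_span_singleton]

lemma mk_eq_zero (c x : OK) : Ideal.Quotient.mk (Ideal.span {c}) x = 0 ↔ c ∣ x := by
  rw [Ideal.Quotient.eq_zero_iff_mem, Ideal.mem_span_singleton]

lemma dvd_rep_sub (c x : OK) : c ∣ rep (Ideal.Quotient.mk (Ideal.span {c}) x) - x := by
  rw [← mk_eq_iff, rep_mk]

lemma eC_congr {c x y : OK} (h : c ∣ x - y) : eC ((x : ℂ) / c) = eC ((y : ℂ) / c) := by
  obtain ⟨t, ht⟩ := h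
  by_cases hc : c = 0
  · subst hc; simp
  have hc' : (c : ℂ) ≠ 0 := by simpa using hc
  have h1 : (x : ℂ) = y + c * t := by
    have := congrArg (Subtype.val) ht
    push_cast at this
    linear_combination this
  have h2 : (x : ℂ) / c = y / c + t := by rw [h1]; field_simp
  rw [h2, eC_add, eC_int, mul_one]

/-- The additive character of `𝒪/(c)`. -/
def psi (c : OK) : AddChar (OK ⧸ Ideal.span {c}) ℂ where
  toFun x := eC ((rep x : ℂ) / c)
  map_zero_eq_one' := by
    have h : c ∣ rep (0 : OK ⧸ Ideal.span {c}) - 0 := by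
      rw [← mk_eq_iff, rep_mk]; simp
    rw [eC_congr h]; simp [eC_zero]
  map_add_eq_mul' x y := by
    have h : c ∣ rep (x + y) - (rep x + rep y) := by
      rw [← mk_eq_iff, rep_mk, map_add, rep_mk, rep_mk]
    rw [eC_congr h, ← eC_add]; push_cast; rw [add_div]

lemma psi_mk (c x : OK) : psi c (Ideal.Quotient.mk _ x) = eC ((x : ℂ) / c) :=
  eC_congr (dvd_rep_sub c x)

lemma psi_apply (c : OK) (x : OK ⧸ Ideal.span {c}) : psi c x = eC ((rep x : ℂ) / c) := rfl

lemma psi_ortho (c : OK) (hc : c ≠ 0) (x : OK ⧸ Ideal.span {c}) (h : ∀ t, psi c (x * t) = 1) :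
    x = 0 := by
  obtain ⟨x, rfl⟩ := Ideal.Quotient.mk_surjective x
  have hc' : (c : ℂ) ≠ 0 := by simpa using hc
  have h1 := h (Ideal.Quotient.mk _ 1)
  have h2 := h (Ideal.Quotient.mk _ om)
  rw [← map_mul, psi_mk] at h1 h2
  obtain ⟨y, hy⟩ := eC_nondeg ((x : ℂ) / c) (by simpa using h1) (by
    rw [← h2]; congr 1; simp [om]; ring)
  rw [mk_eq_zero]
  refine ⟨y, Subtype.ext ?_⟩
  push_cast
  rw [hy]; field_simp

lemma finite_quot (c : OK) (hc : c ≠ 0) : Finite (OK ⧸ Ideal.span {c}) := by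
  obtain ⟨a, b, h⟩ := OK_form c
  set n : ℤ := a ^ 2 - a * b + b ^ 2 with hn
  have hn0 : n ≠ 0 := by
    intro h0
    apply hc
    have hb : b = 0 := by
      have : b ^ 2 ≤ 0 := by nlinarith [sq_nonneg (2 * a - b)]
      nlinarith [pow_eq_zero_iff (two_ne_zero) |>.1 (le_antisymm this (sq_nonneg b))]
    have ha : a = 0 := by
      rw [hb] at hn
      have : a ^ 2 = 0 := by linarith
      exact pow_eq_zero_iff (two_ne_zero) |>.1 this
    rw [h, ha, hb]; simp
  have hd : c ∣ (n : OK) := by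
    refine ⟨a - b - b * om, ?_⟩
    rw [h, hn]; push_cast
    linear_combination (b ^ 2 : OK) * om_quad'
  let f : (Set.Ico 0 |n|) × (Set.Ico 0 |n|) → OK ⧸ Ideal.span {c} := fun q =>
    Ideal.Quotient.mk _ (((q.1 : ℤ) : OK) + ((q.2 : ℤ) : OK) * om)
  apply Finite.of_surjective f
  intro x
  obtain ⟨x, rfl⟩ := Ideal.Quotient.mk_surjective x
  obtain ⟨u, v, rfl⟩ := OK_form x
  refine ⟨(⟨u % n, Int.emod_nonneg _ hn0, Int.emod_lt_abs _ hn0⟩,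
    ⟨v % n, Int.emod_nonneg _ hn0, Int.emod_lt_abs _ hn0⟩), ?_⟩
  simp only [f]
  rw [mk_eq_iff]
  refine hd.trans ⟨-((u / n : ℤ) : OK) - ((v / n : ℤ) : OK) * om, ?_⟩
  have e1 : ((u % n : ℤ) : OK) = u - n * ((u / n : ℤ) : OK) := by
    rw [Int.emod_def]; push_cast; ring
  have e2 : ((v % n : ℤ) : OK) = v - n * ((v / n : ℤ) : OK) := by
    rw [Int.emod_def]; push_cast; ring
  rw [e1, e2]; ring

end OKPart


section PrimePart

lemma fiber_sum {R S : Type} [AddCommGroup R] [AddCommGroup S] [Fintype R] [Fintype S]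
    (f : R →+ S) (hf : Function.Surjective f) (g : S → ℂ) :
    ∑ x, g (f x) = ((Finset.univ.filter (fun x => f x = 0)).card : ℂ) * ∑ y, g y := by
  rw [← Finset.sum_fiberwise Finset.univ (fun x => f x) (fun x => g (f x)), Finset.mul_sum]
  refine Finset.sum_congr rfl fun y _ => ?_
  obtain ⟨x0, rfl⟩ := hf y
  have hc : (Finset.univ.filter (fun x => f x = f x0)).card =
      (Finset.univ.filter (fun x => f x = 0)).card := by
    refine Finset.card_bij (fun x _ => x - x0) ?_ ?_ ?_
    · intro x hx
      simp only [Finset.mem_filter, Finset.mem_univ, true_and] at hx ⊢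
      rw [map_sub, hx, sub_self]
    · intro a _ b _ hab
      exact sub_left_injective hab
    · intro b hb
      simp only [Finset.mem_filter, Finset.mem_univ, true_and] at hb
      exact ⟨b + x0, by simp [hb], by simp⟩
  rw [← hc, ← nsmul_eq_mul, ← Finset.sum_const]
  refine Finset.sum_congr rfl fun z hz => ?_
  rw [(Finset.mem_filter.1 hz).2]

lemma pow_dvd_cancel {p : OK} (hp : p ≠ 0) (i m : ℕ) (x : OK) :
    p ^ (i + m) ∣ p ^ i * x ↔ p ^ m ∣ x := by
  rw [pow_add]
  exact mul_dvd_mul_iff_left (pow_ne_zero i hp)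

lemma field_quot {p : OK} (hp : Prime p) : IsField (OK ⧸ Ideal.span {p}) := by
  have := finite_quot p hp.ne_zero
  have : (Ideal.span {p}).IsPrime := (Ideal.span_singleton_prime hp.ne_zero).2 hp
  exact Finite.isField_of_domain _

lemma coprime_of_not_dvd {p x : OK} (hp : Prime p) (hx : ¬ p ∣ x) : IsCoprime x p := by
  have h0 : Ideal.Quotient.mk (Ideal.span {p}) x ≠ 0 := by rwa [Ne, mk_eq_zero]
  obtain ⟨y, hy⟩ := (field_quot hp).mul_inv_cancel h0
  obtain ⟨y, rfl⟩ := Ideal.Quotient.mk_surjective y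
  rw [← map_mul, ← map_one (Ideal.Quotient.mk (Ideal.span {p})), mk_eq_iff] at hy
  obtain ⟨t, ht⟩ := hy
  exact ⟨y, -t, by linear_combination ht⟩

lemma unit_of_coprime {c x : OK} (h : IsCoprime x c) :
    IsUnit (Ideal.Quotient.mk (Ideal.span {c}) x) := by
  obtain ⟨a, b, h⟩ := h
  apply IsUnit.of_mul_eq_one (Ideal.Quotient.mk _ a)
  rw [← map_mul, ← map_one (Ideal.Quotient.mk (Ideal.span {c})), mk_eq_iff]
  exact ⟨-b, by linear_combination h⟩

lemma mk_unit_iff {p : OK} (hp : Prime p) {k : ℕ} (hk : k ≠ 0) (x : OK) :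
    IsUnit (Ideal.Quotient.mk (Ideal.span {p ^ k}) x) ↔ ¬ p ∣ x := by
  constructor
  · intro h hd
    obtain ⟨y, hy⟩ := h.exists_right_inv
    obtain ⟨y, rfl⟩ := Ideal.Quotient.mk_surjective y
    rw [← map_mul, ← map_one (Ideal.Quotient.mk (Ideal.span {p ^ k})), mk_eq_iff] at hy
    have h1 : p ∣ x * y - 1 := (dvd_pow_self p hk).trans hy
    have h2 : p ∣ 1 := by
      have := dvd_sub (Dvd.dvd.mul_right hd y) h1
      simpa using this
    exact hp.not_isUnit (isUnit_of_dvd_one h2)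
  · intro h
    exact unit_of_coprime ((coprime_of_not_dvd hp h).pow_right)

lemma mk_pow_dvd {p : OK} {i k : ℕ} (hi : i ≤ k) (x : OK) :
    (Ideal.Quotient.mk (Ideal.span {p ^ k}) p) ^ i ∣ Ideal.Quotient.mk _ x ↔ p ^ i ∣ x := by
  constructor
  · rintro ⟨y, hy⟩
    obtain ⟨y, rfl⟩ := Ideal.Quotient.mk_surjective y
    rw [← map_pow, ← map_mul, mk_eq_iff] at hy
    have := (pow_dvd_pow p hi).trans hy
    have := dvd_add this (dvd_mul_right (p ^ i) y)
    simpa using this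
  · intro h
    rw [← map_pow]
    exact map_dvd _ h

lemma cardAnn' {p : OK} (hp : Prime p) (k : ℕ) [Fintype (OK ⧸ Ideal.span {p ^ (k + 1)})] :
    (Finset.univ.filter (fun x : OK ⧸ Ideal.span {p ^ (k + 1)} =>
      Ideal.Quotient.mk _ p * x = 0)).card = Nm p := by
  have := finite_quot p hp.ne_zero
  let := Fintype.ofFinite (OK ⧸ Ideal.span {p})
  unfold Nm
  rw [Nat.card_eq_fintype_card, ← Finset.card_univ]
  symm
  refine Finset.card_bij (fun x _ => Ideal.Quotient.mk _ (p ^ k * rep x)) ?_ ?_ ?_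
  · intro x _
    simp only [Finset.mem_filter, Finset.mem_univ, true_and]
    rw [← map_mul, mk_eq_zero]
    exact ⟨rep x, by ring⟩
  · intro x _ y _ h
    rw [mk_eq_iff, ← mul_sub, pow_succ, mul_dvd_mul_iff_left (pow_ne_zero k hp.ne_zero),
      ← mk_eq_iff, rep_mk, rep_mk] at h
    exact h
  · intro b hb
    simp only [Finset.mem_filter, Finset.mem_univ, true_and] at hb
    obtain ⟨b, rfl⟩ := Ideal.Quotient.mk_surjective b
    rw [← map_mul, mk_eq_zero, pow_succ', mul_dvd_mul_iff_left hp.ne_zero] at hb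
    obtain ⟨c, rfl⟩ := hb
    refine ⟨Ideal.Quotient.mk _ c, Finset.mem_univ _, ?_⟩
    rw [mk_eq_iff, ← mul_sub, pow_succ, mul_dvd_mul_iff_left (pow_ne_zero k hp.ne_zero)]
    exact dvd_rep_sub p c

/-- reduction of the modulus. -/
def red (p : OK) {k l : ℕ} (h : l ≤ k) :
    OK ⧸ Ideal.span {p ^ k} →+* OK ⧸ Ideal.span {p ^ l} :=
  Ideal.Quotient.factor (Ideal.span_singleton_le_span_singleton.2 (pow_dvd_pow p h))

lemma red_mk (p : OK) {k l : ℕ} (h : l ≤ k) (x : OK) :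
    red p h (Ideal.Quotient.mk _ x) = Ideal.Quotient.mk _ x := rfl

lemma red_surj (p : OK) {k l : ℕ} (h : l ≤ k) : Function.Surjective (red p h) := by
  intro x
  obtain ⟨x, rfl⟩ := Ideal.Quotient.mk_surjective x
  exact ⟨Ideal.Quotient.mk _ x, rfl⟩

lemma card_quot {p : OK} (hp : Prime p) (k : ℕ) : Nm (p ^ k) = Nm p ^ k := by
  induction k with
  | zero =>
    rw [pow_zero, pow_zero]
    unfold Nm
    rw [Ideal.span_singleton_one]
    exact Nat.card_unique
  | succ k ih =>
    have := finite_quot (p ^ k) (pow_ne_zero k hp.ne_zero)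
    have := finite_quot (p ^ (k + 1)) (pow_ne_zero (k + 1) hp.ne_zero)
    let := Fintype.ofFinite (OK ⧸ Ideal.span {p ^ k})
    let := Fintype.ofFinite (OK ⧸ Ideal.span {p ^ (k + 1)})
    have h := fiber_sum (red p (Nat.le_succ k)).toAddMonoidHom (red_surj p (Nat.le_succ k))
      (fun _ => 1)
    have h2 : (Finset.univ.filter (fun x : OK ⧸ Ideal.span {p ^ (k + 1)} =>
      (red p (Nat.le_succ k)).toAddMonoidHom x = 0)).card = Nm p := by
      rw [← cardAnn' hp k]
      congr 1
      ext x
      simp only [Finset.mem_filter, Finset.mem_univ, true_and]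
      obtain ⟨x, rfl⟩ := Ideal.Quotient.mk_surjective x
      have e1 : p ^ (k + 1) ∣ p * x ↔ p ^ k ∣ x := by
        rw [pow_succ', mul_dvd_mul_iff_left hp.ne_zero]
      rw [← map_mul, mk_eq_zero, e1, ← mk_eq_zero]
      rfl
    rw [h2] at h
    simp only [Finset.sum_const, Finset.card_univ, nsmul_eq_mul, mul_one] at h
    rw [← Nat.card_eq_fintype_card, ← Nat.card_eq_fintype_card] at h
    have h3 : Nm (p ^ (k + 1)) = Nm p * Nm (p ^ k) := by exact_mod_cast h
    rw [h3, ih, pow_succ']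

lemma Nm_ne {p : OK} (hp : Prime p) : Nm p ≠ 0 := by
  have := finite_quot p hp.ne_zero
  unfold Nm
  exact Nat.card_pos.ne'

lemma LR_quot {p : OK} (hp : Prime p) {k : ℕ} (hk : 1 ≤ k)
    [Fintype (OK ⧸ Ideal.span {p ^ k})] :
    LR (Ideal.Quotient.mk (Ideal.span {p ^ k}) p) k (Nm p) (psi (p ^ k)) where
  hk := hk
  hN := Nm_ne hp
  unit_or x := by
    obtain ⟨x, rfl⟩ := Ideal.Quotient.mk_surjective x
    rw [mk_unit_iff hp (by omega)]
    by_cases h : p ∣ x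
    · exact Or.inr (map_dvd _ h)
    · exact Or.inl h
  not_unit := by
    rw [mk_unit_iff hp (by omega)]; simp
  ann i hi x := by
    obtain ⟨x, rfl⟩ := Ideal.Quotient.mk_surjective x
    rw [mk_pow_dvd (by omega), ← map_pow, ← map_mul, mk_eq_zero]
    have := pow_dvd_cancel hp.ne_zero i (k - i) x
    rwa [show i + (k - i) = k by omega] at this
  card := by
    rw [← Nat.card_eq_fintype_card]; exact card_quot hp k
  cardAnn := by
    obtain ⟨m, rfl⟩ : ∃ m, k = m + 1 := ⟨k - 1, by omega⟩
    exact cardAnn' hp m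
  ortho := psi_ortho _ (pow_ne_zero k hp.ne_zero)

end PrimePart


section CharPart

lemma not_dvd_three {p : OK} (hp : Prime p) (hp3 : (3 : OK) ∣ p - 1) : ¬ p ∣ 3 := by
  intro h
  have h1 := h.trans hp3
  have h2 : p ∣ 1 := by
    have := dvd_sub (dvd_refl p) h1
    simpa using this
  exact hp.not_isUnit (isUnit_of_dvd_one h2)

lemma root_unique {p : OK} (hp : Prime p) (h3 : ¬ p ∣ 3) {ζ η : OK} (hζ : ζ ^ 3 = 1)
    (hη : η ^ 3 = 1) (hd : p ∣ ζ - η) : ζ = η := by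
  by_contra hne
  have h1 : (ζ - η) * (ζ ^ 2 + ζ * η + η ^ 2) = 0 := by linear_combination hζ - hη
  have h2 := (mul_eq_zero.1 h1).resolve_left (sub_ne_zero.2 hne)
  have h4 : p ∣ 3 * η ^ 2 := by
    have h5 : 3 * η ^ 2 = -((ζ - η) * (ζ + 2 * η)) := by linear_combination h2
    rw [h5]
    exact (dvd_neg).2 (Dvd.dvd.mul_right hd _)
  rcases hp.dvd_or_dvd h4 with h | h
  · exact h3 h
  · have h6 : p ∣ 1 := by
      rw [← hη, pow_succ]; exact Dvd.dvd.mul_right h _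
    exact hp.not_isUnit (isUnit_of_dvd_one h6)

lemma om_cube : om ^ 3 = 1 := by linear_combination (om - 1) * om_quad'

lemma fermat {p : OK} (hp : Prime p) {x : OK} (hx : ¬ p ∣ x) : p ∣ x ^ (Nm p - 1) - 1 := by
  have := finite_quot p hp.ne_zero
  let _ := Fintype.ofFinite (OK ⧸ Ideal.span {p})
  let _ := (field_quot hp).toField
  have h0 : Ideal.Quotient.mk (Ideal.span {p}) x ≠ 0 := by rwa [Ne, mk_eq_zero]
  rw [← mk_eq_iff, map_pow, map_one]
  unfold Nm
  rw [Nat.card_eq_fintype_card]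
  exact FiniteField.pow_card_sub_one_eq_one _ h0

lemma card_units_F {p : OK} (hp : Prime p) :
    Nat.card (OK ⧸ Ideal.span {p})ˣ = Nm p - 1 := by
  have := finite_quot p hp.ne_zero
  let _ := Fintype.ofFinite (OK ⧸ Ideal.span {p})
  let _ := (field_quot hp).toField
  unfold Nm
  rw [Nat.card_eq_fintype_card, Nat.card_eq_fintype_card]
  exact Fintype.card_units _

lemma three_dvd {p : OK} (hp : Prime p) (h3 : ¬ p ∣ 3) : 3 ∣ Nm p - 1 := by
  have := finite_quot p hp.ne_zero
  rw [← card_units_F hp]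
  have e : (Ideal.Quotient.mk (Ideal.span {p}) om) ^ 3 = 1 := by rw [← map_pow, om_cube, map_one]
  let u : (OK ⧸ Ideal.span {p})ˣ := Units.ofPowEqOne _ 3 e (by norm_num)
  have hu : u ^ 3 = 1 := Units.ext (by simp [u])
  have hu1 : u ≠ 1 := by
    intro h
    have h1 : Ideal.Quotient.mk (Ideal.span {p}) om = 1 := congrArg Units.val h
    rw [← map_one (Ideal.Quotient.mk (Ideal.span {p})), mk_eq_iff] at h1
    have h2 := root_unique hp h3 om_cube (one_pow 3) h1
    have h4 := congrArg Subtype.val h2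
    exact om_ne_one h4
  have : Fact (Nat.Prime 3) := ⟨Nat.prime_three⟩
  rw [← orderOf_eq_prime hu hu1]
  exact orderOf_dvd_natCard u

lemma C_exists {p : OK} (hp : Prime p) (h3 : ¬ p ∣ 3) {x : OK} (hx : ¬ p ∣ x) :
    ∃ ζ : OK, ζ ^ 3 = 1 ∧ p ∣ ζ - x ^ ((Nm p - 1) / 3) ∧ ¬ p ∣ x := by
  set y := x ^ ((Nm p - 1) / 3) with hy
  have h1 : p ∣ y ^ 3 - 1 := by
    rw [hy, ← pow_mul, Nat.div_mul_cancel (three_dvd hp h3)]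
    exact fermat hp hx
  have h2 : y ^ 3 - 1 = (1 - y) * ((om - y) * (om ^ 2 - y)) * (-1) := by
    linear_combination (y ^ 2 - y * om) * om_quad' + om_cube
  rw [h2] at h1
  have h4 : p ∣ (1 - y) * ((om - y) * (om ^ 2 - y)) := by
    simpa using h1
  rcases hp.dvd_or_dvd h4 with h | h
  · exact ⟨1, one_pow 3, h, hx⟩
  rcases hp.dvd_or_dvd h with h | h
  · exact ⟨om, om_cube, h, hx⟩
  · exact ⟨om ^ 2, by rw [← pow_mul, mul_comm, pow_mul, om_cube, one_pow], h, hx⟩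

lemma C_spec {p : OK} (hp : Prime p) (h3 : ¬ p ∣ 3) {x : OK} (hx : ¬ p ∣ x) :
    cubicCharP p x ^ 3 = 1 ∧ p ∣ cubicCharP p x - x ^ ((Nm p - 1) / 3) := by
  have h := C_exists hp h3 hx
  unfold cubicCharP
  rw [dif_pos h]
  exact ⟨h.choose_spec.1, h.choose_spec.2.1⟩

lemma C_zero {p x : OK} (hx : p ∣ x) : cubicCharP p x = 0 := by
  unfold cubicCharP
  rw [dif_neg]
  rintro ⟨ζ, _, _, h⟩
  exact h hx

lemma C_unique {p : OK} (hp : Prime p) (h3 : ¬ p ∣ 3) {x ζ : OK} (hx : ¬ p ∣ x)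
    (h1 : ζ ^ 3 = 1) (h2 : p ∣ ζ - x ^ ((Nm p - 1) / 3)) : cubicCharP p x = ζ := by
  obtain ⟨h4, h5⟩ := C_spec hp h3 hx
  apply root_unique hp h3 h4 h1
  have := dvd_sub h5 h2
  simpa using this

lemma C_mul {p : OK} (hp : Prime p) (h3 : ¬ p ∣ 3) (x y : OK) :
    cubicCharP p (x * y) = cubicCharP p x * cubicCharP p y := by
  by_cases hx : p ∣ x
  · rw [C_zero hx, C_zero (Dvd.dvd.mul_right hx y), zero_mul]
  by_cases hy : p ∣ y
  · rw [C_zero hy, C_zero (Dvd.dvd.mul_left hy x), mul_zero]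
  obtain ⟨a1, a2⟩ := C_spec hp h3 hx
  obtain ⟨b1, b2⟩ := C_spec hp h3 hy
  apply C_unique hp h3
  · intro h; rcases hp.dvd_or_dvd h with h | h
    · exact hx h
    · exact hy h
  · rw [mul_pow, a1, b1, one_mul]
  · rw [mul_pow]
    have := dvd_add (Dvd.dvd.mul_right a2 (cubicCharP p y))
      (Dvd.dvd.mul_left b2 (x ^ ((Nm p - 1) / 3)))
    convert this using 1; ring

lemma C_congr {p : OK} (hp : Prime p) (h3 : ¬ p ∣ 3) {x y : OK} (h : p ∣ x - y) :
    cubicCharP p x = cubicCharP p y := by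
  by_cases hx : p ∣ x
  · have hy : p ∣ y := by
      have := dvd_sub hx h
      simpa using this
    rw [C_zero hx, C_zero hy]
  · have hy : ¬ p ∣ y := by
      intro hy
      apply hx
      have := dvd_add h hy
      simpa using this
    obtain ⟨b1, b2⟩ := C_spec hp h3 hy
    apply C_unique hp h3 hx b1
    have := dvd_sub b2 (h.trans (sub_dvd_pow_sub_pow x y ((Nm p - 1) / 3)))
    convert this using 1; ring

lemma C_one {p : OK} (hp : Prime p) (h3 : ¬ p ∣ 3) : cubicCharP p 1 = 1 := by
  apply C_unique hp h3
  · intro h; exact hp.not_isUnit (isUnit_of_dvd_one h)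
  · exact one_pow 3
  · simp

lemma C_nontriv {p : OK} (hp : Prime p) (h3 : ¬ p ∣ 3) :
    ∃ x, ¬ p ∣ x ∧ cubicCharP p x ≠ 1 := by
  have hfin := finite_quot p hp.ne_zero
  by_contra hc
  push Not at hc
  let _ := (field_quot hp).toField
  obtain ⟨g, hg⟩ := IsCyclic.exists_ofOrder_eq_natCard (α := (OK ⧸ Ideal.span {p})ˣ)
  have hN : Nat.card (OK ⧸ Ideal.span {p})ˣ = Nm p - 1 := card_units_F hp
  have hpos : 0 < Nm p - 1 := hN ▸ Nat.card_pos
  have h3d := three_dvd hp h3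
  obtain ⟨x, hx⟩ := Ideal.Quotient.mk_surjective (g : OK ⧸ Ideal.span {p})
  have hxp : ¬ p ∣ x := by
    rw [← mk_eq_zero, hx]; exact g.ne_zero
  have h1 := (C_spec hp h3 hxp).2
  rw [hc x hxp, ← mk_eq_iff, map_pow, hx, map_one] at h1
  have h2 : g ^ ((Nm p - 1) / 3) = 1 := Units.ext (by push_cast; exact h1.symm)
  have h4 := orderOf_dvd_of_pow_eq_one h2
  rw [hg, hN] at h4
  have := Nat.le_of_dvd (by omega) h4
  omega

/-- The cubic character on `𝒪/(p^k)`. -/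
def Xk {p : OK} (hp : Prime p) (h3 : ¬ p ∣ 3) {k : ℕ} (hk : k ≠ 0) :
    MulChar (OK ⧸ Ideal.span {p ^ k}) ℂ where
  toFun x := (cubicCharP p (rep x) : ℂ)
  map_one' := by
    have h : p ∣ rep (1 : OK ⧸ Ideal.span {p ^ k}) - 1 := by
      refine (dvd_pow_self p hk).trans ?_
      rw [← mk_eq_iff, rep_mk, map_one]
    rw [C_congr hp h3 h, C_one hp h3]; simp
  map_mul' x y := by
    have h : p ∣ rep (x * y) - rep x * rep y := by
      refine (dvd_pow_self p hk).trans ?_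
      rw [← mk_eq_iff, rep_mk, map_mul, rep_mk, rep_mk]
    rw [C_congr hp h3 h, C_mul hp h3]; simp
  map_nonunit' x hx := by
    rw [← rep_mk x, mk_unit_iff hp hk, not_not] at hx
    rw [C_zero hx]; simp

lemma Xk_apply {p : OK} (hp : Prime p) (h3 : ¬ p ∣ 3) {k : ℕ} (hk : k ≠ 0)
    (x : OK ⧸ Ideal.span {p ^ k}) : Xk hp h3 hk x = (cubicCharP p (rep x) : ℂ) := rfl

lemma Xk_mk {p : OK} (hp : Prime p) (h3 : ¬ p ∣ 3) {k : ℕ} (hk : k ≠ 0) (x : OK) :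
    Xk hp h3 hk (Ideal.Quotient.mk _ x) = (cubicCharP p x : ℂ) := by
  rw [Xk_apply, C_congr hp h3 ((dvd_pow_self p hk).trans (dvd_rep_sub _ x))]

lemma Xk_cube {p : OK} (hp : Prime p) (h3 : ¬ p ∣ 3) {k : ℕ} (hk : k ≠ 0) :
    Xk hp h3 hk ^ 3 = 1 := by
  ext u
  rw [MulChar.pow_apply_coe, MulChar.one_apply_coe]
  obtain ⟨x, hx⟩ := Ideal.Quotient.mk_surjective (u : OK ⧸ Ideal.span {p ^ k})
  have hu := u.isUnit
  rw [← hx, mk_unit_iff hp hk] at hu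
  rw [← hx, Xk_mk]
  have := (C_spec hp h3 hu).1
  exact_mod_cast congrArg Subtype.val this

lemma Xk_ne {p : OK} (hp : Prime p) (h3 : ¬ p ∣ 3) {k : ℕ} (hk : k ≠ 0) :
    Xk hp h3 hk ≠ 1 := by
  intro h
  obtain ⟨x, hx, hx1⟩ := C_nontriv hp h3
  apply hx1
  have h1 := DFunLike.congr_fun h (Ideal.Quotient.mk _ x)
  rw [Xk_mk, MulChar.one_apply ((mk_unit_iff hp hk x).2 hx)] at h1
  exact_mod_cast h1

lemma Xk_sq_ne {p : OK} (hp : Prime p) (h3 : ¬ p ∣ 3) {k : ℕ} (hk : k ≠ 0) :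
    Xk hp h3 hk ^ 2 ≠ 1 := by
  intro h
  have h1 := Xk_cube hp h3 hk
  rw [pow_succ, h, one_mul] at h1
  exact Xk_ne hp h3 hk h1

lemma Xk_shift {p : OK} (hp : Prime p) (h3 : ¬ p ∣ 3) {k : ℕ} (hk : k ≠ 0)
    (A t : OK ⧸ Ideal.span {p ^ k}) :
    Xk hp h3 hk (A + Ideal.Quotient.mk _ p * t) = Xk hp h3 hk A := by
  obtain ⟨A, rfl⟩ := Ideal.Quotient.mk_surjective A
  obtain ⟨t, rfl⟩ := Ideal.Quotient.mk_surjective t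
  rw [← map_mul, ← map_add, Xk_mk, Xk_mk, C_congr hp h3 (y := A) (by simp)]

lemma cubicCharP_assoc {p q : OK} (h : Associated q p) (x : OK) :
    cubicCharP q x = cubicCharP p x := by
  have hN : Nm q = Nm p := by
    unfold Nm
    rw [Ideal.span_singleton_eq_span_singleton.2 h]
  have hd : ∀ y, q ∣ y ↔ p ∣ y := fun y => h.dvd_iff_dvd_left
  unfold cubicCharP
  simp only [hN, hd]

lemma cubicChar_prime {p : OK} (hp : Prime p) (x : OK) : cubicChar p x = cubicCharP p x := by
  have h : ∃ fs : OKˣ × Multiset OK, (∀ π ∈ fs.2, Prime π) ∧ p = (fs.1 : OK) * fs.2.prod :=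
    ⟨(1, {p}), by simpa using hp, by simp⟩
  unfold cubicChar
  rw [dif_pos h]
  obtain ⟨h1, h2⟩ := h.choose_spec
  generalize h.choose = fs at h1 h2 ⊢
  obtain ⟨u, s⟩ := fs
  simp only at h1 h2 ⊢
  have h4 : p ∣ s.prod := by
    have : p ∣ (u : OK) * s.prod := h2 ▸ dvd_refl p
    rwa [Units.dvd_mul_left] at this
  obtain ⟨q, hq, hd⟩ := hp.exists_mem_multiset_dvd h4
  obtain ⟨t, rfl⟩ := Multiset.exists_cons_of_mem hq
  obtain ⟨d, rfl⟩ := hd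
  rw [Multiset.prod_cons] at h2
  have h5 : (u : OK) * d * t.prod = 1 := by
    apply mul_left_cancel₀ hp.ne_zero
    linear_combination -h2
  have ht : t = 0 := by
    by_contra ht
    obtain ⟨r, hr⟩ := Multiset.exists_mem_of_ne_zero ht
    have hrp := h1 r (Multiset.mem_cons_of_mem hr)
    apply hrp.not_isUnit
    apply isUnit_of_dvd_one
    rw [← h5]
    exact (Multiset.dvd_prod hr).mul_left _
  subst ht
  simp only [Multiset.prod_zero, mul_one] at h2 h5
  simp only [Multiset.cons_zero, Multiset.map_singleton, Multiset.prod_singleton]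
  apply cubicCharP_assoc
  refine ⟨u, ?_⟩
  linear_combination -h2

lemma span_dvd {p : OK} (I : Ideal OK) (h : I ≤ Ideal.span {p}) : Ideal.span {p} ∣ I := by
  refine ⟨Submodule.comap (LinearMap.mulLeft OK p) I, ?_⟩
  ext x
  rw [Ideal.mem_span_singleton_mul]
  constructor
  · intro hx
    obtain ⟨y, rfl⟩ := Ideal.mem_span_singleton.1 (h hx)
    exact ⟨y, hx, rfl⟩
  · rintro ⟨y, hy, rfl⟩
    exact hy

lemma prime_span {p : OK} (hp : Prime p) : Prime (Ideal.span {p}) := by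
  have hP : (Ideal.span {p}).IsPrime := (Ideal.span_singleton_prime hp.ne_zero).2 hp
  refine ⟨?_, ?_, ?_⟩
  · intro h
    exact hp.ne_zero (Ideal.span_singleton_eq_bot.1 h)
  · intro h
    rw [Ideal.isUnit_iff] at h
    exact hP.ne_top h
  · intro I J hIJ
    have : I * J ≤ Ideal.span {p} := Ideal.le_of_dvd hIJ
    rcases hP.mul_le.1 this with h | h
    · exact Or.inl (span_dvd I h)
    · exact Or.inr (span_dvd J h)

lemma moebius_prime {p : OK} (hp : Prime p) : moebius p = -1 := by
  have h : ∃ s : Finset (Ideal OK), (∀ P ∈ s, Prime P) ∧ Ideal.span {p} = ∏ P ∈ s, P :=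
    ⟨{Ideal.span {p}}, by simpa using prime_span hp, by simp⟩
  unfold moebius
  rw [dif_pos h]
  obtain ⟨h1, h2⟩ := h.choose_spec
  generalize h.choose = s at h1 h2 ⊢
  obtain ⟨P, hP, J, hJ⟩ := (prime_span hp).exists_mem_finset_dvd (f := fun Q => Q) (dvd_of_eq h2)
  have h4 : Ideal.span {p} * (J * ∏ Q ∈ s.erase P, Q) = Ideal.span {p} * 1 := by
    rw [mul_one, ← mul_assoc, ← hJ, Finset.mul_prod_erase s (fun Q => Q) hP, ← h2]
  rw [Ideal.span_singleton_mul_right_inj hp.ne_zero] at h4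
  have h5 : s.erase P = ∅ := by
    by_contra hne
    obtain ⟨Q, hQ⟩ := Finset.nonempty_iff_ne_empty.2 hne
    apply (h1 Q (Finset.mem_of_mem_erase hQ)).not_isUnit
    apply isUnit_of_dvd_one
    rw [← h4]
    exact (Finset.dvd_prod_of_mem (fun Q => Q) hQ).mul_left _
  have h6 := Finset.card_erase_add_one hP
  rw [h5] at h6
  rw [← h6]; simp

lemma mk_invMod (c x : OK) : Ideal.Quotient.mk (Ideal.span {c}) (invMod c x) =
    Ring.inverse (Ideal.Quotient.mk _ x) := rep_mk _

end CharPart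


section Assembly

lemma isField_eval {R : Type} [CommRing R] [Fintype R] (hR : IsField R) (ψ : AddChar R ℂ)
    (hψ : ψ.IsPrimitive) (ζ : R) (h3 : (3 : R) ≠ 0) (hζ : ζ ^ 2 + ζ + 1 = 0)
    (X : MulChar R ℂ) (hX3 : X ^ 3 = 1) (hX1 : X ≠ 1) (w b : R) (hw : w ≠ 0) :
    ∑ A, X A * ∑ y, ψ (Ring.inverse (w * A) + A * w ^ 2 * y ^ 3 + b * y) =
      -(X w * ∑ z, X z * ψ z) +
        (Fintype.card R : ℂ) * ψ (b ^ 3 * Ring.inverse (3 ^ 3 * w)) := by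
  let _ : Field R := hR.toField
  simp only [Ring.inverse_eq_inv']
  exact field_eval ψ hψ ζ h3 hζ X hX3 hX1 w b hw

lemma isField_eval_one {R : Type} [CommRing R] [Fintype R] (hR : IsField R) (ψ : AddChar R ℂ)
    (X : MulChar R ℂ) (hX3 : X ^ 3 = 1) (hX1 : X ≠ 1) (w : R) (hw : w ≠ 0) :
    ∑ A, X A * ∑ x, ψ (A * w ^ 2 * x ^ 3) =
      ((Fintype.card R : ℂ) - 1) * X w * ∑ z, X z * ψ z := by
  let _ : Field R := hR.toField
  exact field_eval_one ψ X hX3 hX1 w hw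

lemma S9_eq {p : OK} (hp : Prime p) (h3 : ¬ p ∣ 3) (w B : OK) (j : ℕ) {k : ℕ} (hk : k ≠ 0)
    [Fintype (OK ⧸ Ideal.span {p ^ k})] :
    S9 p w B j k = SR (Ideal.Quotient.mk (Ideal.span {p ^ k}) p) (psi (p ^ k)) (Xk hp h3 hk ^ k)
      (Ideal.Quotient.mk _ w) (Ideal.Quotient.mk _ B) j := by
  unfold S9 SR
  rw [finsum_eq_sum_of_fintype, LR.sum_units (R := OK ⧸ Ideal.span {p ^ k})]
  · refine Finset.sum_congr rfl fun u _ => ?_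
    rw [finsum_eq_sum_of_fintype, mul_assoc, Finset.mul_sum]
    congr 1
    · rw [MulChar.pow_apply_coe, Xk_apply]; push_cast; rfl
    · refine Finset.sum_congr rfl fun t _ => ?_
      rw [← psi_mk, ← psi_mk, ← AddChar.map_add_eq_mul]
      congr 1
      simp only [map_add, map_mul, map_pow, mk_invMod, rep_mk]
      ring
  · intro x hx
    rw [MulChar.map_nonunit _ hx, zero_mul]

lemma psi_red {p : OK} (hp : Prime p) {i l k : ℕ} (h : i + l = k) (hl : l ≤ k)
    (z : OK ⧸ Ideal.span {p ^ k}) :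
    psi (p ^ k) (Ideal.Quotient.mk _ p ^ i * z) = psi (p ^ l) (red p hl z) := by
  obtain ⟨x, rfl⟩ := Ideal.Quotient.mk_surjective z
  rw [red_mk, ← map_pow, ← map_mul, psi_mk, psi_mk]
  congr 1
  subst h
  have hp0 : (p : ℂ) ≠ 0 := by simpa using hp.ne_zero
  push_cast
  rw [pow_add]
  field_simp

lemma hom_inverse {R S : Type} [CommRing R] [CommRing S] (f : R →+* S) {z : R} (hz : IsUnit z) :
    f (Ring.inverse z) = Ring.inverse (f z) := by
  have h1 := Ring.mul_inverse_cancel _ hz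
  have h2 := Ring.mul_inverse_cancel _ (hz.map f)
  have h3 : f z * f (Ring.inverse z) = 1 := by rw [← map_mul, h1, map_one]
  linear_combination (-f (Ring.inverse z)) * h2 + Ring.inverse (f z) * h3

lemma gauss_eq {p : OK} (hp : Prime p) (h3 : ¬ p ∣ 3) [Fintype (OK ⧸ Ideal.span {p ^ 1})] :
    gaussSum 1 p = ∑ z, Xk hp h3 one_ne_zero z * psi (p ^ 1) z := by
  have e : gaussSum 1 p = gaussSum 1 (p ^ 1) := by rw [pow_one]
  rw [e]
  unfold gaussSum
  rw [finsum_eq_sum_of_fintype, LR.sum_units (R := OK ⧸ Ideal.span {p ^ 1})]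
  · refine Finset.sum_congr rfl fun u _ => ?_
    rw [Xk_apply, psi_apply, one_mul]
    congr 2
    have : ∀ x, cubicChar (p ^ 1) x = cubicCharP p x := by
      intro x; rw [pow_one, cubicChar_prime hp]
    rw [this]
  · intro x hx
    rw [MulChar.map_nonunit _ hx, zero_mul]

lemma field_one {p : OK} (hp : Prime p) : IsField (OK ⧸ Ideal.span {p ^ 1}) := by
  rw [pow_one]; exact field_quot hp

lemma F_eval {p : OK} (hp : Prime p) (h3 : ¬ p ∣ 3) [inst : Fintype (OK ⧸ Ideal.span {p ^ 1})]
    (w b : OK ⧸ Ideal.span {p ^ 1}) (hw : IsUnit w) :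
    ∑ A, Xk hp h3 one_ne_zero A * ∑ y, psi (p ^ 1) (Ring.inverse (w * A) + A * w ^ 2 * y ^ 3 + b * y)
      = -(Xk hp h3 one_ne_zero w * gaussSum 1 p) +
        (Nm p : ℂ) * psi (p ^ 1) (b ^ 3 * Ring.inverse (3 ^ 3 * w)) := by
  rw [gauss_eq hp h3]
  have L := LR_quot hp (k := 1) le_rfl
  have hcard : (Fintype.card (OK ⧸ Ideal.span {p ^ 1}) : ℂ) = Nm p := by
    rw [L.card, pow_one]
  rw [← hcard]
  have h30 : (3 : OK ⧸ Ideal.span {p ^ 1}) ≠ 0 := by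
    have : (Ideal.Quotient.mk (Ideal.span {p ^ 1}) 3) ≠ 0 := by
      rw [Ne, mk_eq_zero, pow_one]; exact h3
    rwa [map_ofNat] at this
  have hz : (Ideal.Quotient.mk (Ideal.span {p ^ 1}) om) ^ 2 + Ideal.Quotient.mk _ om + 1 = 0 := by
    rw [← map_pow, ← map_add, ← map_one (Ideal.Quotient.mk (Ideal.span {p ^ 1})), ← map_add,
      om_quad', map_zero]
  have hprim : (psi (p ^ 1)).IsPrimitive := by
    intro a ha h1
    apply ha
    apply L.ortho
    intro t
    have := DFunLike.congr_fun h1 t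
    simpa [AddChar.mulShift_apply] using this
  have := (field_one hp).nontrivial
  exact isField_eval (field_one hp) (psi (p ^ 1)) hprim (Ideal.Quotient.mk _ om) h30 hz (Xk hp h3 one_ne_zero)
    (Xk_cube hp h3 one_ne_zero) (Xk_ne hp h3 one_ne_zero) w b hw.ne_zero

lemma F_eval_one {p : OK} (hp : Prime p) (h3 : ¬ p ∣ 3)
    [inst : Fintype (OK ⧸ Ideal.span {p ^ 1})]
    (w : OK ⧸ Ideal.span {p ^ 1}) (hw : IsUnit w) :
    ∑ A, Xk hp h3 one_ne_zero A * ∑ x, psi (p ^ 1) (A * w ^ 2 * x ^ 3)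
      = ((Nm p : ℂ) - 1) * Xk hp h3 one_ne_zero w * gaussSum 1 p := by
  rw [gauss_eq hp h3]
  have L := LR_quot hp (k := 1) le_rfl
  have hcard : (Fintype.card (OK ⧸ Ideal.span {p ^ 1}) : ℂ) = Nm p := by
    rw [L.card, pow_one]
  rw [← hcard]
  have := (field_one hp).nontrivial
  exact isField_eval_one (field_one hp) (psi (p ^ 1)) (Xk hp h3 one_ne_zero)
    (Xk_cube hp h3 one_ne_zero) (Xk_ne hp h3 one_ne_zero) w hw.ne_zero

lemma S_one {p : OK} (hp : Prime p) (h3 : ¬ p ∣ 3) (w B : OK) (hw : ¬ p ∣ w) (j : ℕ)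
    (hj : 1 ≤ j) :
    S9 p w B j 1 = (totient p : ℂ) * ((cubicCharP p w : OK) : ℂ) * gaussSum 1 p := by
  have := finite_quot (p ^ 1) (pow_ne_zero 1 hp.ne_zero)
  let _ := Fintype.ofFinite (OK ⧸ Ideal.span {p ^ 1})
  rw [S9_eq hp h3 w B j one_ne_zero]
  have L := LR_quot hp (k := 1) le_rfl
  unfold SR
  rw [L.pi_ge (m := 3) (by omega), L.pi_ge (m := j) hj]
  simp only [zero_mul, add_zero, zero_add, pow_one (Xk hp h3 one_ne_zero)]
  rw [F_eval_one hp h3 _ ((mk_unit_iff hp one_ne_zero w).2 hw), Xk_mk]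
  have ht : (totient p : ℂ) = (Nm p : ℂ) - 1 := by
    unfold totient
    rw [card_units_F hp, Nat.cast_sub (Nat.one_le_iff_ne_zero.2 (Nm_ne hp)), Nat.cast_one]
  rw [ht]

lemma S_four {p : OK} (hp : Prime p) (h3 : ¬ p ∣ 3) (w B : OK) (hw : ¬ p ∣ w) (j : ℕ)
    (hj : 2 ≤ j) :
    S9 p w B j 4 = (Nm p : ℂ) ^ 5 *
      ((moebius p : ℂ) * ((cubicCharP p w : OK) : ℂ) * gaussSum 1 p +
        (Nm p : ℂ) * psi (p ^ 1) (Ideal.Quotient.mk _ (p ^ (j - 2) * B) ^ 3 *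
          Ring.inverse (3 ^ 3 * Ideal.Quotient.mk _ w))) := by
  have := finite_quot (p ^ 1) (pow_ne_zero 1 hp.ne_zero)
  let _ := Fintype.ofFinite (OK ⧸ Ideal.span {p ^ 1})
  have := finite_quot (p ^ 4) (pow_ne_zero 4 hp.ne_zero)
  let _ := Fintype.ofFinite (OK ⧸ Ideal.span {p ^ 4})
  have L := LR_quot hp (k := 4) (by norm_num)
  have L1 := LR_quot hp (k := 1) le_rfl
  have h4 : (4 : ℕ) ≠ 0 := by norm_num
  have hX : Xk hp h3 h4 ^ 4 = Xk hp h3 h4 := by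
    rw [pow_succ (Xk hp h3 h4) 3, Xk_cube, one_mul]
  have hwu := (mk_unit_iff hp h4 w).2 hw
  rw [S9_eq hp h3 w B j h4, hX]
  apply mul_left_cancel₀ L.NC
  rw [L.step_one (by norm_num) _ (Xk_shift hp h3 h4) _ _ hwu]
  set r := red p (show 1 ≤ 4 by norm_num) with hr
  set w1 := Ideal.Quotient.mk (Ideal.span {p ^ 1}) w with hw1
  set b1 := Ideal.Quotient.mk (Ideal.span {p ^ 1}) (p ^ (j - 2) * B) with hb1
  have hfib : ∀ g : OK ⧸ Ideal.span {p ^ 1} → ℂ, ∑ x, g (r x) = (Nm p : ℂ) ^ 3 * ∑ y, g y := by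
    intro g
    have e1 := fiber_sum r.toAddMonoidHom (red_surj p (show 1 ≤ 4 by norm_num)) (fun _ => 1)
    have e2 := fiber_sum r.toAddMonoidHom (red_surj p (show 1 ≤ 4 by norm_num)) g
    simp only [Finset.sum_const, Finset.card_univ, nsmul_eq_mul, mul_one, L.card, L1.card,
      Nat.cast_pow, pow_one] at e1
    have e4 : (Nm p : ℂ) ^ 3 =
        ((Finset.univ.filter (fun x => r.toAddMonoidHom x = 0)).card : ℂ) := by
      apply mul_right_cancel₀ L.NC
      rw [← e1]; ring
    rw [e4]
    exact e2
  have key : ∀ A y : OK ⧸ Ideal.span {p ^ 4}, Xk hp h3 h4 A *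
      psi (p ^ 4) (Ideal.Quotient.mk _ p ^ 3 * (Ring.inverse (Ideal.Quotient.mk _ w * A) +
        A * Ideal.Quotient.mk _ w ^ 2 * y ^ 3) +
        Ideal.Quotient.mk _ p ^ (j + 1) * Ideal.Quotient.mk _ B * y) =
      Xk hp h3 one_ne_zero (r A) * psi (p ^ 1) (Ring.inverse (w1 * r A) + r A * w1 ^ 2 * r y ^ 3 +
        b1 * r y) := by
    intro A y
    have hXA : Xk hp h3 h4 A = Xk hp h3 one_ne_zero (r A) := by
      obtain ⟨a, rfl⟩ := Ideal.Quotient.mk_surjective A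
      rw [hr, red_mk, Xk_mk, Xk_mk]
    rw [hXA]
    by_cases hA : IsUnit A
    · congr 1
      have e1 : Ideal.Quotient.mk (Ideal.span {p ^ 4}) p ^ 3 *
          (Ring.inverse (Ideal.Quotient.mk _ w * A) +
          A * Ideal.Quotient.mk _ w ^ 2 * y ^ 3) +
          Ideal.Quotient.mk _ p ^ (j + 1) * Ideal.Quotient.mk _ B * y =
          Ideal.Quotient.mk _ p ^ 3 *
          (Ring.inverse (Ideal.Quotient.mk _ w * A) +
          A * Ideal.Quotient.mk _ w ^ 2 * y ^ 3 + Ideal.Quotient.mk _ (p ^ (j - 2) * B) * y) := by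
        rw [show j + 1 = 3 + (j - 2) by omega, pow_add, map_mul, map_pow]; ring
      rw [e1, psi_red hp (l := 1) (by norm_num) (by norm_num)]
      congr 1
      simp only [map_add, map_mul (red p _), map_pow (red p _), hom_inverse _ (hwu.mul hA), red_mk]
      rfl
    · rw [← hXA, MulChar.map_nonunit _ hA, zero_mul, zero_mul]
  simp only [Finset.mul_sum]
  simp only [key]
  have e5 : ∀ A : OK ⧸ Ideal.span {p ^ 4}, ∑ y, Xk hp h3 one_ne_zero (r A) *
      psi (p ^ 1) (Ring.inverse (w1 * r A) + r A * w1 ^ 2 * r y ^ 3 + b1 * r y) =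
      (Nm p : ℂ) ^ 3 * ∑ y, Xk hp h3 one_ne_zero (r A) *
        psi (p ^ 1) (Ring.inverse (w1 * r A) + r A * w1 ^ 2 * y ^ 3 + b1 * y) := fun A =>
    hfib (fun y => Xk hp h3 one_ne_zero (r A) *
      psi (p ^ 1) (Ring.inverse (w1 * r A) + r A * w1 ^ 2 * y ^ 3 + b1 * y))
  rw [Finset.sum_congr rfl fun A _ => e5 A, ← Finset.mul_sum,
    hfib (fun A => ∑ y, Xk hp h3 one_ne_zero A *
      psi (p ^ 1) (Ring.inverse (w1 * A) + A * w1 ^ 2 * y ^ 3 + b1 * y))]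
  have e6 := F_eval hp h3 w1 b1 ((mk_unit_iff hp one_ne_zero w).2 hw)
  simp only [Finset.mul_sum] at e6
  rw [e6, hw1, Xk_mk, moebius_prime hp]
  push_cast
  ring

lemma isUnit_three_quot {p : OK} (hp : Prime p) (h3 : ¬ p ∣ 3) {k : ℕ} (hk : k ≠ 0) :
    IsUnit (3 : OK ⧸ Ideal.span {p ^ k}) := by
  have := (mk_unit_iff hp hk 3).2 h3
  rwa [map_ofNat] at this

lemma Xpow_cube {p : OK} (hp : Prime p) (h3 : ¬ p ∣ 3) {k : ℕ} (hk : k ≠ 0) (n : ℕ) :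
    (Xk hp h3 hk ^ n) ^ 3 = 1 := by
  rw [← pow_mul, mul_comm, pow_mul, Xk_cube, one_pow]

lemma Xpow_shift {p : OK} (hp : Prime p) (h3 : ¬ p ∣ 3) {k : ℕ} (hk : k ≠ 0) (n : ℕ)
    (hn : n ≠ 0) (A t : OK ⧸ Ideal.span {p ^ k}) :
    (Xk hp h3 hk ^ n) (A + Ideal.Quotient.mk _ p * t) = (Xk hp h3 hk ^ n) A := by
  rw [MulChar.pow_apply' _ hn, MulChar.pow_apply' _ hn, Xk_shift]

end Assembly


/- Statement 9 -/
theorem stmt9 (p w B : OK) (hp : Prime p) (hp3 : (3 : OK) ∣ p - 1)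
    (hco : IsCoprime (w * B) p) :
    (∀ j : ℕ, 1 ≤ j →
      S9 p w B j 1 = (totient p : ℂ) * ((cubicCharP p w : OK) : ℂ) * gaussSum 1 p) ∧
    (∀ j : ℕ, 2 ≤ j → S9 p w B j 3 = (totient (p ^ 3) : ℂ) * (Nm p : ℂ) ^ 2) ∧
    (S9 p w B 2 4 = (Nm p : ℂ) ^ 5 *
      ((moebius p : ℂ) * ((cubicCharP p w : OK) : ℂ) * gaussSum 1 p +
        (Nm p : ℂ) * eC (((B ^ 3 * invMod p (3 ^ 3 * w) : OK) : ℂ) / (p : ℂ)))) ∧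
    (∀ j : ℕ, 3 ≤ j → S9 p w B j 4 = (Nm p : ℂ) ^ 5 *
      ((moebius p : ℂ) * ((cubicCharP p w : OK) : ℂ) * gaussSum 1 p + (Nm p : ℂ))) ∧
    (∀ k : ℕ, 5 ≤ k → S9 p w B 2 k = (Nm p : ℂ) ^ (k + 2) *
      eC (((B ^ 3 * invMod (p ^ (k - 3)) (3 ^ 3 * w) : OK) : ℂ) / ((p ^ (k - 3) : OK) : ℂ))) ∧
    (∀ j k : ℕ, 1 ≤ j →
      (k = 2 ∨ (k = 3 ∧ j = 1) ∨ (k = 4 ∧ j = 1) ∨ (5 ≤ k ∧ j ≠ 2)) →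
      S9 p w B j k = 0) := by
  have h3 := not_dvd_three hp hp3
  have hwB : ¬ p ∣ w * B := by
    intro h
    exact hp.not_isUnit (hco.isUnit_of_dvd' h (dvd_refl p))
  have hw : ¬ p ∣ w := fun h => hwB (Dvd.dvd.mul_right h B)
  have hB : ¬ p ∣ B := fun h => hwB (Dvd.dvd.mul_left h w)
  refine ⟨fun j hj => S_one hp h3 w B hw j hj, ?_, ?_, ?_, ?_, ?_⟩
  · intro j hj
    have := finite_quot (p ^ 3) (pow_ne_zero 3 hp.ne_zero)
    let _ := Fintype.ofFinite (OK ⧸ Ideal.span {p ^ 3})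
    have L := LR_quot hp (k := 3) (by norm_num)
    have hk : (3 : ℕ) ≠ 0 := by norm_num
    rw [S9_eq hp h3 w B j hk, Xk_cube, L.case_three rfl _ _ ((mk_unit_iff hp hk w).2 hw) j hj]
    unfold totient
    rw [Nat.card_eq_fintype_card]
  · rw [S_four hp h3 w B hw 2 le_rfl]
    congr 3
    have e : eC (((B ^ 3 * invMod p (3 ^ 3 * w) : OK) : ℂ) / (p : ℂ)) =
        eC (((B ^ 3 * invMod (p ^ 1) (3 ^ 3 * w) : OK) : ℂ) / ((p ^ 1 : OK) : ℂ)) := by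
      rw [pow_one]
    rw [e, ← psi_mk]
    congr 1
    simp only [map_mul, map_pow, mk_invMod, map_ofNat]
    simp
  · intro j hj
    rw [S_four hp h3 w B hw j (by omega)]
    congr 2
    have h0 : Ideal.Quotient.mk (Ideal.span {p ^ 1}) (p ^ (j - 2) * B) = 0 := by
      rw [mk_eq_zero]
      exact Dvd.dvd.mul_right (pow_dvd_pow p (by omega)) _
    rw [h0]
    simp
  · intro k hk5
    have := finite_quot (p ^ k) (pow_ne_zero k hp.ne_zero)
    let _ := Fintype.ofFinite (OK ⧸ Ideal.span {p ^ k})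
    have hk : k ≠ 0 := by omega
    have L := LR_quot hp (k := k) (by omega)
    have hwu := (mk_unit_iff hp hk w).2 hw
    have h3u := isUnit_three_quot hp h3 hk
    have hz : (Ideal.Quotient.mk (Ideal.span {p ^ k}) om) ^ 2 + Ideal.Quotient.mk _ om + 1 = 0 := by
      rw [← map_pow, ← map_add, ← map_one (Ideal.Quotient.mk (Ideal.span {p ^ k})), ← map_add,
        om_quad', map_zero]
    rw [S9_eq hp h3 w B 2 hk, L.case_main hk5 _ (Xpow_shift hp h3 hk k hk) (Xpow_cube hp h3 hk k)
      h3u _ hz _ _ hwu ((mk_unit_iff hp hk B).2 hB),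
      psi_red hp (i := 3) (l := k - 3) (by omega) (by omega), ← psi_mk]
    congr 2
    simp only [map_mul (red p _), map_pow (red p _), hom_inverse _ ((h3u.pow 3).mul hwu), red_mk,
      map_mul (Ideal.Quotient.mk _), map_pow (Ideal.Quotient.mk _), mk_invMod, map_ofNat]
  · intro j k hj hcases
    have hk : k ≠ 0 := by omega
    have := finite_quot (p ^ k) (pow_ne_zero k hp.ne_zero)
    let _ := Fintype.ofFinite (OK ⧸ Ideal.span {p ^ k})
    have L := LR_quot hp (k := k) (by omega)
    have hwu := (mk_unit_iff hp hk w).2 hw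
    have hBu := (mk_unit_iff hp hk B).2 hB
    have h3u := isUnit_three_quot hp h3 hk
    have hsh := Xpow_shift hp h3 hk k hk
    rw [S9_eq hp h3 w B j hk]
    by_cases hk2 : k = 2
    · refine L.case_two hk2 _ hsh ?_ _ _ hwu j hj
      have := Xk_sq_ne hp h3 hk
      intro h
      apply this
      rw [← h]
      exact congrArg (fun n => Xk hp h3 hk ^ n) hk2.symm
    by_cases hj1 : j = 1
    · subst hj1
      exact L.case_j_one (by omega) _ hsh _ _ hwu hBu
    · exact L.case_zero (by omega) _ hsh (Xpow_cube hp h3 hk k) h3u _ _ hwu j (by omega)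

end CubicSeries
end
end

section
/- Let p ≡ 1 (mod 3) be a rational prime and write p = π·π′, where π is a prime element of 𝒪 = ℤ[ω] with π ≡ 1 (mod 3) and π′ is its complex conjugate. Let A ∈ ℤ with gcd(A, p) = 1. Then, under the standard embedding of 𝒪 into ℂ, S(A x³, p) = g(A, π) + conj(g(A, π)), where g(A, π) := ∑_{y (π)} (y/π)₃ · exp(2πi · Tr_{K/ℚ}(A y / π)) and conj denotes complex conjugation. -/
noncomputable section

namespace CubicAppendix

open scoped Classical

/-- `S(Ax³, c) := ∑_{j=0}^{c−1} exp(2πi A j³ / c)`. -/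
def S (A : ℤ) (c : ℕ) : ℂ :=
  ∑ j ∈ Finset.range c,
    Complex.exp (2 * Real.pi * Complex.I * (A : ℂ) * (j : ℂ) ^ 3 / (c : ℂ))

/-- `ω = exp(2πi/3)`, a primitive cube root of unity in `ℂ`. -/
def ω : ℂ := Complex.exp (2 * Real.pi * Complex.I / 3)

/-- `𝒪 = ℤ[ω]`, the ring of Eisenstein integers, embedded in `ℂ` via `ω ↦ exp(2πi/3)`. -/
def O : Subring ℂ := Subring.closure {ω}

abbrev OK : Type _ := O

/-- A choice of representative in `𝒪` for a residue class. -/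
def rep {I : Ideal OK} (x : OK ⧸ I) : OK :=
  Function.surjInv Ideal.Quotient.mk_surjective x

/-- `N(c) = |𝒪/(c)|`, the absolute norm. -/
def Nm (c : OK) : ℕ := Nat.card (OK ⧸ Ideal.span {c})

/-- The cubic residue symbol `(x/π)₃` for a prime element `π` not dividing `3`:
the unique cube root of unity congruent to `x^{(N(π)-1)/3}` mod `π`, and `0` if `π ∣ x`. -/
def cubicCharP (π x : OK) : OK :=
  if h : ∃ ζ : OK, ζ ^ 3 = 1 ∧ π ∣ ζ - x ^ ((Nm π - 1) / 3) ∧ ¬ π ∣ x then h.choose else 0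

/-- The cubic Gauss sum `g(A,π) = ∑_{y (π)} (y/π)₃ exp(2πi Tr_{K/ℚ}(A y/π))`, where for
`z ∈ K ⊂ ℂ` one has `Tr_{K/ℚ}(z) = z + conj z`. -/
def g (A : ℤ) (π : OK) : ℂ :=
  ∑ᶠ y : OK ⧸ Ideal.span {π},
    ((cubicCharP π (rep y) : OK) : ℂ) *
      Complex.exp (2 * Real.pi * Complex.I *
        ((A : ℂ) * (rep y : ℂ) / (π : ℂ) +
          (starRingEnd ℂ) ((A : ℂ) * (rep y : ℂ) / (π : ℂ))))
lemma w_prim : IsPrimitiveRoot ω 3 := by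
  have := Complex.isPrimitiveRoot_exp 3 (by norm_num)
  simpa [ω] using this

lemma w_rel : ω ^ 2 + ω + 1 = 0 := by
  have h := w_prim.geom_sum_eq_zero (by norm_num)
  simp [Finset.sum_range_succ] at h
  linear_combination h

lemma w_cube : ω ^ 3 = 1 := w_prim.pow_eq_one

lemma conj_of_cube {z : ℂ} (hz : z ^ 3 = 1) : (starRingEnd ℂ) z = z ^ 2 := by
  have hn : ‖z‖ = 1 := Complex.norm_eq_one_of_pow_eq_one hz (by norm_num)
  have h1 : z * (starRingEnd ℂ) z = 1 := by
    rw [Complex.mul_conj, Complex.normSq_eq_norm_sq, hn]; simp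
  have : z ≠ 0 := by rintro rfl; simp at hz
  apply mul_left_cancel₀ this
  rw [h1, ← hz]; ring

lemma conj_w : (starRingEnd ℂ) ω = -1 - ω := by
  rw [conj_of_cube w_cube]; linear_combination w_rel

/-- `ω` as an element of `𝒪`. -/
def wO : OK := ⟨ω, Subring.subset_closure rfl⟩

lemma wO_prim : IsPrimitiveRoot wO 3 :=
  IsPrimitiveRoot.of_map_of_injective (f := O.subtype) (by simpa [wO] using w_prim)
    Subtype.coe_injective

lemma O_repr (x : ℂ) (hx : x ∈ O) : ∃ a b : ℤ, x = a + b * ω := by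
  induction hx using Subring.closure_induction with
  | mem x hx => exact ⟨0, 1, by simp_all⟩
  | zero => exact ⟨0, 0, by simp⟩
  | one => exact ⟨1, 0, by simp⟩
  | add x y _ _ h1 h2 =>
    obtain ⟨a, b, rfl⟩ := h1; obtain ⟨c, d, rfl⟩ := h2
    exact ⟨a + c, b + d, by push_cast; ring⟩
  | neg x _ h1 =>
    obtain ⟨a, b, rfl⟩ := h1
    exact ⟨-a, -b, by push_cast; ring⟩
  | mul x y _ _ h1 h2 =>
    obtain ⟨a, b, rfl⟩ := h1; obtain ⟨c, d, rfl⟩ := h2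
    refine ⟨a * c - b * d, a * d + b * c - b * d, ?_⟩
    push_cast
    linear_combination (b * d : ℂ) * w_rel

lemma O_repr' (x : OK) : ∃ a b : ℤ, x = (a : OK) + (b : OK) * wO := by
  obtain ⟨a, b, h⟩ := O_repr x x.2
  exact ⟨a, b, Subtype.ext (by simpa [wO] using h)⟩

lemma conj_mem (x : OK) : (starRingEnd ℂ) (x : ℂ) ∈ O := by
  obtain ⟨a, b, rfl⟩ := O_repr' x
  have : (starRingEnd ℂ) (((a : OK) + (b : OK) * wO : OK) : ℂ)
      = (((a : OK) + (b : OK) * (-1 - wO) : OK) : ℂ) := by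
    simp [wO, conj_w]
  rw [this]; exact Subtype.property _

lemma trace_int (x : OK) : ∃ n : ℤ, (x : ℂ) + (starRingEnd ℂ) (x : ℂ) = n := by
  obtain ⟨a, b, rfl⟩ := O_repr' x
  refine ⟨2 * a - b, ?_⟩
  simp [wO, conj_w]; ring

lemma norm_int (x : OK) : ∃ n : ℤ, Complex.normSq (x : ℂ) = n := by
  obtain ⟨a, b, rfl⟩ := O_repr' x
  refine ⟨a ^ 2 - a * b + b ^ 2, ?_⟩
  apply Complex.ofReal_injective
  rw [Complex.normSq_eq_conj_mul_self]
  simp [wO, conj_w]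
  linear_combination -(b ^ 2 : ℂ) * w_rel

/-- a norm one element congruent to `-1` mod 3 is `-1` -/
lemma unit_eq (u z : OK) (hu : Complex.normSq (u : ℂ) = 1) (h : u + 1 = 3 * z) : u = -1 := by
  obtain ⟨n, hn⟩ := norm_int z
  have h' : (u : ℂ) + 1 = 3 * z := congrArg (Subtype.val) h
  have hz : ‖(z : ℂ)‖ < 1 := by
    have h1 : ‖(u : ℂ)‖ = 1 := by
      rw [Complex.normSq_eq_norm_sq] at hu
      nlinarith [norm_nonneg (u : ℂ)]
    have h2 := norm_add_le (u : ℂ) 1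
    rw [h', h1] at h2
    simp at h2
    linarith
  have hn0 : n = 0 := by
    have h1 : (n : ℝ) < 1 := by
      rw [← hn, Complex.normSq_eq_norm_sq]; nlinarith [norm_nonneg (z : ℂ)]
    have h2 : (0 : ℝ) ≤ n := by rw [← hn]; exact Complex.normSq_nonneg _
    norm_cast at h1 h2
    omega
  have hz0 : z = 0 := by
    rw [hn0] at hn
    simpa using hn
  rw [hz0] at h
  linear_combination h
section Fp
variable {p : ℕ} [Fact p.Prime] {k : ℕ}

lemma sum_pow_all (i : ℕ) (hi : 0 < i) :
    ∑ t : ZMod p, t ^ i = if p - 1 ∣ i then -1 else 0 := by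
  have h := FiniteField.sum_pow_units (ZMod p) i
  rw [ZMod.card] at h
  rw [← h, ← Fintype.sum_subtype_add_sum_subtype (fun t : ZMod p => t ≠ 0) (fun t => t ^ i)]
  have h0 : ∑ t : {t : ZMod p // ¬ t ≠ 0}, (t : ZMod p) ^ i = 0 := by
    apply Finset.sum_eq_zero
    rintro ⟨t, ht⟩ _
    have : t = 0 := by simpa using ht
    simp [this, hi.ne']
  rw [h0, add_zero]
  exact (Fintype.sum_equiv unitsEquivNeZero _ _ (fun x => by simp)).symm

lemma sum_expand (m n : ℕ) : ∑ t : ZMod p, t ^ m * (1 - t) ^ n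
    = ∑ i ∈ Finset.range (n + 1), ((-1) ^ i * (n.choose i : ZMod p)) * ∑ t : ZMod p, t ^ (m + i) := by
  simp_rw [Finset.mul_sum]
  rw [Finset.sum_comm]
  apply Finset.sum_congr rfl
  intro t _
  rw [show (1 - t) = -t + 1 by ring, add_pow, Finset.mul_sum]
  apply Finset.sum_congr rfl
  intro i _
  rw [neg_pow]
  ring

lemma sumA (hk : p = 3 * k + 1) (hk0 : 0 < k) : ∑ t : ZMod p, t ^ k * (1 - t) ^ k = 0 := by
  rw [sum_expand]
  apply Finset.sum_eq_zero
  intro i hi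
  rw [Finset.mem_range] at hi
  rw [sum_pow_all _ (by omega), if_neg, mul_zero]
  intro h
  have := Nat.le_of_dvd (by omega) h
  omega

lemma sumB (hk : p = 3 * k + 1) (hk0 : 0 < k) :
    ∑ t : ZMod p, t ^ (2 * k) * (1 - t) ^ (2 * k) = - ((-1) ^ k * ((2 * k).choose k : ZMod p)) := by
  rw [sum_expand, Finset.sum_eq_single k]
  · rw [sum_pow_all _ (by omega), if_pos ⟨1, by omega⟩, mul_neg_one]
  · intro i hi hik
    rw [Finset.mem_range] at hi
    rw [sum_pow_all _ (by omega), if_neg, mul_zero]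
    rintro ⟨c, hc⟩
    rw [show p - 1 = 3 * k by omega] at hc
    have h1 : c ≠ 0 := by rintro rfl; omega
    have h2 : c ≠ 1 := by rintro rfl; omega
    have h3 : 2 ≤ c := by omega
    have : 3 * k * 2 ≤ 3 * k * c := Nat.mul_le_mul_left _ h3
    omega
  · intro h; simp at h; omega

lemma fact_rel (hk : p = 3 * k + 1) :
    ((-1) ^ k * ((2 * k).choose k : ZMod p)) * (k.factorial : ZMod p) ^ 3 = -1 := by
  have hdesc : ∀ j, j ≤ 3 * k → (((3 * k).descFactorial j : ℕ) : ZMod p) = (-1) ^ j * j.factorial := by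
    intro j
    induction j with
    | zero => simp
    | succ j ih =>
      intro hj
      rw [Nat.descFactorial_succ, Nat.cast_mul, ih (by omega), Nat.cast_sub (by omega),
        Nat.factorial_succ]
      have : ((3 * k + 1 : ℕ) : ZMod p) = 0 := by rw [← hk]; simp
      push_cast at this ⊢
      linear_combination ((-1) ^ j * (j.factorial : ZMod p)) * this
  have h1 : ((3 * k).factorial : ZMod p) = -1 := by
    have := ZMod.wilsons_lemma p
    rwa [show p - 1 = 3 * k by omega] at this
  have h2 := Nat.factorial_mul_descFactorial (show k ≤ 3 * k by omega)
  rw [show 3 * k - k = 2 * k by omega] at h2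
  have h3 := Nat.choose_mul_factorial_mul_factorial (show k ≤ 2 * k by omega)
  rw [show 2 * k - k = k by omega] at h3
  rw [← h2, ← h3] at h1
  push_cast at h1
  rw [hdesc k (by omega)] at h1
  linear_combination h1

/-- an element that is `±` an inverse cube has trivial `k`-th power -/
lemma pow_k_eq_one (hk : p = 3 * k + 1) (hk0 : 0 < k) (a : ZMod p)
    (ha : a = (-1) ^ k * ((2 * k).choose k : ZMod p)) : a ^ k = 1 := by
  have h := fact_rel hk
  rw [← ha] at h
  have hev : Even k := by
    have := (Fact.out : p.Prime).eq_two_or_odd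
    rcases Nat.even_or_odd k with h | h
    · exact h
    · obtain ⟨m, rfl⟩ := h; omega
  have hf : (k.factorial : ZMod p) ≠ 0 := by
    intro h0; rw [h0] at h; simp at h
  have h2 := congrArg (· ^ k) h
  simp only [mul_pow, hev.neg_one_pow, ← pow_mul] at h2
  rwa [← show p - 1 = 3 * k by omega, ZMod.pow_card_sub_one_eq_one hf, mul_one] at h2

lemma cube_of_pow (hk : p = 3 * k + 1) (hk0 : 0 < k) (t : ZMod p) (ht : t ^ k = 1) :
    ∃ s, s ^ 3 = t := by
  have ht0 : t ≠ 0 := by rintro rfl; rw [zero_pow hk0.ne'] at ht; exact zero_ne_one ht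
  obtain ⟨g, hg⟩ := IsCyclic.exists_generator (α := (ZMod p)ˣ)
  obtain ⟨m, hm⟩ := Submonoid.mem_powers_iff _ _ |>.1 (mem_powers_iff_mem_zpowers.2 (hg (Units.mk0 t ht0)))
  have ho : orderOf g = 3 * k := by
    rw [orderOf_eq_card_of_forall_mem_zpowers hg, Nat.card_eq_fintype_card, ZMod.card_units]; omega
  have h1 : g ^ (m * k) = 1 := by
    rw [pow_mul, hm]; ext; simpa using ht
  have h2 := orderOf_dvd_of_pow_eq_one h1
  rw [ho] at h2
  obtain ⟨c, rfl⟩ := Nat.dvd_of_mul_dvd_mul_right hk0 h2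
  refine ⟨((g ^ c : (ZMod p)ˣ) : ZMod p), ?_⟩
  rw [← Units.val_pow_eq_pow_val, ← pow_mul, mul_comm, hm]; rfl

lemma exists_r (hk : p = 3 * k + 1) : ∃ r : ZMod p, r ^ 2 + r + 1 = 0 := by
  have : Fact (Nat.Prime 3) := ⟨Nat.prime_three⟩
  obtain ⟨u, hu⟩ := exists_prime_orderOf_dvd_card (G := (ZMod p)ˣ) 3
    (by rw [ZMod.card_units]; exact ⟨k, by omega⟩)
  have h3 : IsPrimitiveRoot (u : ZMod p) 3 := by
    rw [IsPrimitiveRoot.coe_units_iff, ← hu]; exact IsPrimitiveRoot.orderOf u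
  refine ⟨u, ?_⟩
  have h := h3.geom_sum_eq_zero (by norm_num)
  simp [Finset.sum_range_succ] at h
  linear_combination h

end Fp
section Main
variable {p : ℕ} [Fact p.Prime] {k : ℕ}

lemma exists_equiv (hk : p = 3 * k + 1) (π : OK) (hπ : Prime π) (hd : π ∣ (p : OK)) :
    Nonempty ((OK ⧸ Ideal.span {π}) ≃+* ZMod p) := by
  have hI : (Ideal.span {π}).IsPrime := (Ideal.span_singleton_prime hπ.ne_zero).2 hπ
  have h0 : ((p : ℕ) : OK ⧸ Ideal.span {π}) = 0 := by
    have := Ideal.Quotient.eq_zero_iff_mem.2 (Ideal.mem_span_singleton.2 hd)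
    simpa using this
  have hc : CharP (OK ⧸ Ideal.span {π}) p := (CharP.charP_iff_prime_eq_zero Fact.out).2 h0
  let f : ZMod p →+* OK ⧸ Ideal.span {π} := ZMod.castHom (dvd_refl p) _
  have hw : ∃ s : ZMod p, f s = Ideal.Quotient.mk _ wO := by
    obtain ⟨r, hr⟩ := exists_r hk
    have h1 : f r ^ 2 + f r + 1 = 0 := by
      have := congrArg f hr
      simpa using this
    have h2 : wO ^ 2 + wO + 1 = 0 := Subtype.ext (by simpa [wO] using w_rel)
    have h3 := congrArg (Ideal.Quotient.mk (Ideal.span {π})) h2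
    simp only [map_add, map_pow, map_one, map_zero] at h3
    set W := Ideal.Quotient.mk (Ideal.span {π}) wO
    have h4 : (f r - W) * (f (-1 - r) - W) = 0 := by
      simp only [map_sub, map_neg, map_one]
      linear_combination h3 - h1
    rcases mul_eq_zero.1 h4 with h | h
    · exact ⟨r, sub_eq_zero.1 h⟩
    · exact ⟨_, sub_eq_zero.1 h⟩
  obtain ⟨s, hs⟩ := hw
  refine ⟨(RingEquiv.ofBijective f ⟨f.injective, ?_⟩).symm⟩
  intro y
  obtain ⟨x, rfl⟩ := Ideal.Quotient.mk_surjective y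
  obtain ⟨a, b, rfl⟩ := O_repr' x
  exact ⟨a + b * s, by simp [hs]⟩

lemma phi_prim (hk : p = 3 * k + 1) (φ : OK →+* ZMod p) :
    IsPrimitiveRoot (φ wO) 3 := by
  have h3 : Fact (Nat.Prime 3) := ⟨Nat.prime_three⟩
  have h1 : φ wO ^ 3 = 1 := by rw [← map_pow, wO_prim.pow_eq_one, map_one]
  have h2 : φ wO ≠ 1 := by
    intro h
    have h2 : wO ^ 2 + wO + 1 = 0 := Subtype.ext (by simpa [wO] using w_rel)
    have h4 := congrArg φ h2
    simp only [map_add, map_pow, map_one, map_zero, h] at h4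
    have h5 : ((3 : ℕ) : ZMod p) = 0 := by push_cast; linear_combination h4
    rw [ZMod.natCast_eq_zero_iff] at h5
    have := (Nat.prime_dvd_prime_iff_eq Fact.out Nat.prime_three).1 h5
    omega
  rw [← orderOf_eq_prime h1 h2]
  exact IsPrimitiveRoot.orderOf _

lemma phi_inj (hk : p = 3 * k + 1) (φ : OK →+* ZMod p) {x y : OK} (hx : x ^ 3 = 1) (hy : y ^ 3 = 1)
    (h : φ x = φ y) : x = y := by
  obtain ⟨i, hi, rfl⟩ := wO_prim.eq_pow_of_pow_eq_one hx
  obtain ⟨j, hj, rfl⟩ := wO_prim.eq_pow_of_pow_eq_one hy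
  rw [map_pow, map_pow] at h
  rw [(phi_prim hk φ).pow_inj hi hj h]

lemma exists_lift (hk : p = 3 * k + 1) (φ : OK →+* ZMod p) (t : ZMod p) (ht : t ≠ 0) :
    ∃ z : OK, z ^ 3 = 1 ∧ φ z = t ^ k := by
  have h : (t ^ k) ^ 3 = 1 := by
    rw [← pow_mul, ← ZMod.pow_card_sub_one_eq_one ht]; congr 1; omega
  obtain ⟨i, hi, h⟩ := (phi_prim hk φ).eq_pow_of_pow_eq_one h
  exact ⟨wO ^ i, by rw [← pow_mul, mul_comm, pow_mul, wO_prim.pow_eq_one, one_pow], by simpa using h⟩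

lemma exists_char (hk : p = 3 * k + 1) (hk0 : 0 < k) (φ : OK →+* ZMod p) :
    ∃ χ : MulChar (ZMod p) OK, (∀ t, φ (χ t) = t ^ k) ∧ ∀ t, t ≠ 0 → χ t ^ 3 = 1 := by
  choose! f hf using exists_lift hk φ
  let F : ZMod p → OK := fun t => if t = 0 then 0 else f t
  have hF : ∀ t, t ≠ 0 → F t ^ 3 = 1 ∧ φ (F t) = t ^ k := by
    intro t ht
    simp only [F, if_neg ht]
    exact hf t ht
  refine ⟨{ toFun := F, map_one' := ?_, map_mul' := ?_, map_nonunit' := ?_ }, ?_, ?_⟩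
  · exact phi_inj hk φ (hF 1 one_ne_zero).1 (one_pow 3) (by rw [(hF 1 one_ne_zero).2]; simp)
  · intro x y
    by_cases hx : x = 0
    · simp [F, hx]
    by_cases hy : y = 0
    · simp [F, hy]
    have hxy := mul_ne_zero hx hy
    apply phi_inj hk φ (hF _ hxy).1
    · simp only [mul_pow, (hF _ hx).1, (hF _ hy).1, one_mul]
    · simp only [map_mul, (hF _ hx).2, (hF _ hy).2, (hF _ hxy).2, mul_pow]
  · intro x hx
    have : x = 0 := by simpa [isUnit_iff_ne_zero] using hx
    simp [F, this]
  · intro t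
    by_cases ht : t = 0
    · subst ht
      show φ (F 0) = _
      simp [F, hk0.ne']
    · exact (hF t ht).2
  · intro t ht
    exact (hF t ht).1

/-- The key fact (a consequence of the evaluation of the cubic Jacobi sum). -/
lemma key (hk : p = 3 * k + 1) (hk0 : 0 < k) (π π' : OK) (hπ3 : (3 : OK) ∣ π - 1)
    (hconj : (π' : ℂ) = (starRingEnd ℂ) (π : ℂ)) (hfac : (p : OK) = π * π')
    (φ : OK →+* ZMod p) (hφ : ∀ x, φ x = 0 ↔ π ∣ x)
    (χ : MulChar (ZMod p) OK) (h1 : ∀ t, φ (χ t) = t ^ k) (h3 : ∀ t, t ≠ 0 → χ t ^ 3 = 1) :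
    (φ π') ^ k = 1 := by
  apply pow_k_eq_one hk hk0
  have hχ3 : χ ^ 3 = 1 := by
    ext t
    rw [MulChar.pow_apply_coe, h3 _ t.ne_zero, MulChar.one_apply_coe]
  have hinv : χ⁻¹ = χ ^ 2 := by
    rw [inv_eq_iff_mul_eq_one, ← pow_succ', hχ3]
  -- `π ∣ J`
  obtain ⟨u, hu⟩ : π ∣ jacobiSum χ χ := by
    rw [← hφ, jacobiSum, map_sum]
    simp_rw [map_mul, h1]
    exact sumA hk hk0
  have hJ' : φ (jacobiSum χ⁻¹ χ⁻¹) = - ((-1) ^ k * ((2 * k).choose k : ZMod p)) := by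
    rw [← sumB hk hk0, jacobiSum, map_sum, hinv]
    simp_rw [map_mul, MulChar.pow_apply' χ two_ne_zero, map_pow, h1, ← pow_mul, mul_comm k 2]
  -- nontriviality
  have hχ2 : χ ^ 2 ≠ 1 := by
    intro h
    have ha : ∀ t : ZMod p, t ^ (2 * k) = t ^ (3 * k) := by
      intro t
      by_cases ht : t = 0
      · rw [ht, zero_pow (by omega), zero_pow (by omega)]
      · have h4 : χ t ^ 2 = 1 := by
          rw [← MulChar.pow_apply' χ two_ne_zero, h, MulChar.one_apply (isUnit_iff_ne_zero.2 ht)]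
        have h5 := congrArg φ h4
        rw [map_pow, h1, map_one, ← pow_mul, mul_comm] at h5
        rw [h5, ← ZMod.pow_card_sub_one_eq_one ht]; congr 1; omega
    have hs : ∑ t : ZMod p, t ^ (2 * k) = ∑ t : ZMod p, t ^ (3 * k) :=
      Finset.sum_congr rfl fun t _ => ha t
    rw [sum_pow_all _ (by omega), sum_pow_all _ (by omega), if_neg, if_pos ⟨1, by omega⟩] at hs
    · simp at hs
    · intro h
      have := Nat.le_of_dvd (by omega) h
      omega
  have hχ1 : χ ≠ 1 := by
    rintro rfl; simp at hχ2
  have hJJ : jacobiSum χ χ * jacobiSum χ⁻¹ χ⁻¹ = (p : OK) := by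
    have hinj : Function.Injective O.subtype := Subtype.coe_injective
    have hne : ∀ ψ : MulChar (ZMod p) OK, ψ ≠ 1 → ψ.ringHomComp O.subtype ≠ 1 :=
      fun ψ h => (MulChar.ringHomComp_ne_one_iff hinj).2 h
    have hchar : ringChar ℂ ≠ ringChar (ZMod p) := by
      rw [ZMod.ringChar_zmod_n, ringChar.eq_zero]
      exact (Fact.out : p.Prime).ne_zero.symm
    have h := jacobiSum_mul_jacobiSum_inv hchar (hne χ hχ1) (hne χ hχ1)
      (by rw [← MulChar.ringHomComp_mul, ← pow_two]; exact hne _ hχ2)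
    rw [MulChar.ringHomComp_inv, jacobiSum_ringHomComp, jacobiSum_ringHomComp, ← map_mul,
      ZMod.card] at h
    apply hinj
    rw [h]; simp
  have hcJ : (starRingEnd ℂ) ((jacobiSum χ χ : OK) : ℂ) = (jacobiSum χ⁻¹ χ⁻¹ : OK) := by
    have hcc : ∀ t, (starRingEnd ℂ) (χ t : ℂ) = ((χ ^ 2) t : OK) := by
      intro t
      rw [MulChar.pow_apply' χ two_ne_zero]
      by_cases ht : t = 0
      · simp [ht, MulChar.map_zero]
      · exact conj_of_cube (congrArg Subtype.val (h3 t ht))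
    simp only [jacobiSum, hinv]
    push_cast
    simp only [map_sum, map_mul, hcc]
  have hp0 : (p : ℂ) ≠ 0 := by exact_mod_cast (Fact.out : p.Prime).ne_zero
  have hπ0 : π ≠ 0 := by
    rintro rfl
    apply hp0
    have := congrArg Subtype.val hfac
    simpa using this
  have huJ : u * jacobiSum χ⁻¹ χ⁻¹ = π' := by
    apply mul_left_cancel₀ hπ0
    rw [← hfac, ← hJJ, hu]; ring
  have hun : Complex.normSq (u : ℂ) = 1 := by
    have e1 : Complex.normSq ((jacobiSum χ χ : OK) : ℂ) = p := by
      apply Complex.ofReal_injective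
      rw [← Complex.mul_conj, hcJ]
      have := congrArg Subtype.val hJJ
      simpa using this
    have e2 : Complex.normSq (π : ℂ) = p := by
      apply Complex.ofReal_injective
      rw [← Complex.mul_conj, ← hconj]
      have := congrArg Subtype.val hfac
      simpa using this.symm
    rw [hu] at e1
    push_cast at e1
    rw [map_mul, e2] at e1
    have hp0' : (p : ℝ) ≠ 0 := by exact_mod_cast (Fact.out : p.Prime).ne_zero
    exact mul_left_cancel₀ hp0' (by rw [e1, mul_one])
  obtain ⟨z, -, hz⟩ := exists_jacobiSum_eq_neg_one_add (by norm_num) hχ3 hχ3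
    (by rw [ZMod.card]; exact ⟨k, by omega⟩) wO_prim
  obtain ⟨c, hc⟩ := hπ3
  have hw : wO ^ 2 + wO + 1 = 0 := Subtype.ext (by simpa [wO] using w_rel)
  have hu1 : u = -1 := by
    apply unit_eq u (-z * wO - u * c) hun
    rw [hu] at hz
    linear_combination hz - u * hc + z * hw
  rw [← huJ, hu1, map_mul, hJ']
  simp
end Main

section Final
variable {p : ℕ} [Fact p.Prime] {k : ℕ}

lemma count_cubes (hk : p = 3 * k + 1) (hk0 : 0 < k) (φ : OK →+* ZMod p)
    (χ : MulChar (ZMod p) OK) (h1 : ∀ t, φ (χ t) = t ^ k) (h3 : ∀ t, t ≠ 0 → χ t ^ 3 = 1)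
    (t : ZMod p) :
    ((Finset.univ.filter (fun j : ZMod p => j ^ 3 = t)).card : ℂ)
      = 1 + (χ t : ℂ) + (χ t : ℂ) ^ 2 := by
  by_cases ht : t = 0
  · have : Finset.univ.filter (fun j : ZMod p => j ^ 3 = t) = {0} := by
      ext j; simp [ht]
    rw [this, ht, MulChar.map_zero]; simp
  by_cases htk : t ^ k = 1
  · have hχ : χ t = 1 := phi_inj hk φ (h3 t ht) (one_pow 3) (by rw [h1, htk, map_one])
    obtain ⟨s, hs⟩ := cube_of_pow hk hk0 t htk
    have hs0 : s ≠ 0 := by rintro rfl; apply ht; rw [← hs]; simp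
    have hρ := phi_prim hk φ
    have : Finset.univ.filter (fun j : ZMod p => j ^ 3 = t)
        = (Finset.range 3).image (fun i => (φ wO) ^ i * s) := by
      ext j
      simp only [Finset.mem_filter, Finset.mem_univ, true_and, Finset.mem_image, Finset.mem_range]
      constructor
      · intro hj
        obtain ⟨i, hi, h⟩ := hρ.eq_pow_of_pow_eq_one
          (show (j / s) ^ 3 = 1 by rw [div_pow, hj, hs, div_self ht])
        exact ⟨i, hi, by rw [h]; field_simp⟩
      · rintro ⟨i, -, rfl⟩
        rw [mul_pow, hs, ← pow_mul, mul_comm i, pow_mul, hρ.pow_eq_one, one_pow, one_mul]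
    rw [this, Finset.card_image_of_injOn, hχ]
    · norm_num
    · intro i hi j hj h
      exact hρ.pow_inj (by simpa using hi) (by simpa using hj) (mul_right_cancel₀ hs0 h)
  · have : Finset.univ.filter (fun j : ZMod p => j ^ 3 = t) = ∅ := by
      rw [Finset.filter_eq_empty_iff]
      rintro j - rfl
      apply htk
      have hj : j ≠ 0 := by rintro rfl; simp at ht
      rw [← pow_mul, ← ZMod.pow_card_sub_one_eq_one hj]; congr 1; omega
    have hne : χ t - 1 ≠ 0 := by
      intro h
      apply htk
      rw [← h1, sub_eq_zero.1 h, map_one]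
    have h0 : 1 + χ t + χ t ^ 2 = 0 := by
      apply mul_left_cancel₀ hne
      linear_combination h3 t ht
    rw [this]
    have := congrArg Subtype.val h0
    simpa using this.symm

lemma S_eq (hk : p = 3 * k + 1) (hk0 : 0 < k) (φ : OK →+* ZMod p)
    (χ : MulChar (ZMod p) OK) (h1 : ∀ t, φ (χ t) = t ^ k) (h3 : ∀ t, t ≠ 0 → χ t ^ 3 = 1)
    (A : ℤ) (hA : (A : ZMod p) ≠ 0) :
    S A p = ∑ t : ZMod p, ((χ t : ℂ) + (χ t : ℂ) ^ 2) * ZMod.stdAddChar ((A : ZMod p) * t) := by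
  have e1 : S A p = ∑ j : ZMod p, ZMod.stdAddChar ((A : ZMod p) * j ^ 3) := by
    unfold S
    refine Finset.sum_nbij' (fun j => (j : ZMod p)) ZMod.val ?_ ?_ ?_ ?_ ?_
    · simp
    · intro j _; simpa using ZMod.val_lt j
    · intro j hj; exact ZMod.val_cast_of_lt (by simpa using hj)
    · intro j _; simp
    · intro j _
      have := ZMod.stdAddChar_coe (N := p) (A * (j : ℤ) ^ 3)
      push_cast at this
      rw [this]; congr 1; ring
  have e2 : ∑ j : ZMod p, (ZMod.stdAddChar ((A : ZMod p) * j ^ 3) : ℂ)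
      = ∑ t : ZMod p, (1 + (χ t : ℂ) + (χ t : ℂ) ^ 2) * ZMod.stdAddChar ((A : ZMod p) * t) := by
    rw [← Finset.sum_fiberwise Finset.univ (fun j : ZMod p => j ^ 3)]
    apply Finset.sum_congr rfl
    intro t _
    rw [← count_cubes hk hk0 φ χ h1 h3 t, ← nsmul_eq_mul, ← Finset.sum_const]
    apply Finset.sum_congr rfl
    intro j hj
    rw [(Finset.mem_filter.1 hj).2]
  have e3 : ∑ t : ZMod p, (ZMod.stdAddChar ((A : ZMod p) * t) : ℂ) = 0 := by
    have := AddChar.sum_mulShift (A : ZMod p) (ZMod.isPrimitive_stdAddChar p)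
    rw [if_neg hA] at this
    simpa [mul_comm] using this
  rw [e1, e2, ← sub_zero (∑ t : ZMod p, _ * _), ← e3, ← Finset.sum_sub_distrib]
  apply Finset.sum_congr rfl
  intro t _
  ring

lemma exp_eq (π π' : OK) (hconj : (π' : ℂ) = (starRingEnd ℂ) (π : ℂ)) (hfac : (p : OK) = π * π')
    (φ : OK →+* ZMod p) (hφ : ∀ x, φ x = 0 ↔ π ∣ x) (A : ℤ) (x : OK) :
    Complex.exp (2 * Real.pi * Complex.I *
        ((A : ℂ) * (x : ℂ) / (π : ℂ) + (starRingEnd ℂ) ((A : ℂ) * (x : ℂ) / (π : ℂ))))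
      = ZMod.stdAddChar ((A : ZMod p) * (φ π' * φ x)) := by
  have hp0 : (p : ℂ) ≠ 0 := by exact_mod_cast (Fact.out : p.Prime).ne_zero
  have hfac' : (p : ℂ) = (π : ℂ) * π' := by
    have := congrArg Subtype.val hfac
    simpa using this
  have hπ0 : (π : ℂ) ≠ 0 := by rintro h; rw [h] at hfac'; simp at hfac'; exact hp0 (by simpa using hfac')
  have hπ0' : (π' : ℂ) ≠ 0 := by rintro h; rw [h] at hfac'; simp at hfac'; exact hp0 (by simpa using hfac')
  obtain ⟨a, ha⟩ := trace_int π
  have hφa : φ π' = (a : ZMod p) := by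
    have : π + π' = (a : OK) := Subtype.ext (by simpa [hconj] using ha)
    have h := congrArg φ this
    rwa [map_add, (hφ π).2 dvd_rfl, zero_add, map_intCast] at h
  let t : ℤ := ((φ x).val : ℤ)
  have ht : (t : ZMod p) = φ x := by simp [t]
  obtain ⟨z, hz⟩ : π ∣ x - (t : OK) := by
    rw [← hφ, map_sub, map_intCast, ht, sub_self]
  obtain ⟨m, hm⟩ := trace_int z
  have hx : (x : ℂ) = t + π * z := by
    have := congrArg Subtype.val hz
    simp at this
    linear_combination this
  rw [hφa, ← ht]
  have hstd := ZMod.stdAddChar_coe (N := p) (A * (a * t))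
  push_cast at hstd
  rw [hstd]
  rw [Complex.exp_eq_exp_iff_exists_int]
  refine ⟨A * m, ?_⟩
  rw [hx, hfac']
  simp only [map_div₀, map_mul, map_add, map_intCast, ← hconj] at ha ⊢
  push_cast
  rw [← ha, ← hm]
  field_simp
  ring

end Final

/- Statement 19 -/
theorem stmt19 (p : ℕ) (hp : p.Prime) (hp3 : p % 3 = 1)
    (π : OK) (hπ : Prime π) (hπ3 : (3 : OK) ∣ π - 1)
    (hfac : (p : ℂ) = (π : ℂ) * (starRingEnd ℂ) (π : ℂ))
    (A : ℤ) (hA : Int.gcd A p = 1) :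
    S A p = g A π + (starRingEnd ℂ) (g A π) := by
  have : Fact p.Prime := ⟨hp⟩
  obtain ⟨k, hk⟩ : ∃ k, p = 3 * k + 1 := ⟨p / 3, by omega⟩
  have hk0 : 0 < k := by
    have := hp.two_le
    omega
  have hA0 : (A : ZMod p) ≠ 0 := by
    rw [Ne, ZMod.intCast_zmod_eq_zero_iff_dvd]
    intro h
    have h2 : (p : ℤ) ∣ Int.gcd A p := Int.dvd_coe_gcd h dvd_rfl
    rw [hA] at h2
    have h3 : p ∣ 1 := by exact_mod_cast h2
    exact hp.one_lt.ne' (Nat.dvd_one.1 h3)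
  let π' : OK := ⟨_, conj_mem π⟩
  have hconj : (π' : ℂ) = (starRingEnd ℂ) (π : ℂ) := rfl
  have hfac' : (p : OK) = π * π' := Subtype.ext (by simpa [hconj] using hfac)
  obtain ⟨e⟩ := exists_equiv hk π hπ ⟨π', hfac'⟩
  let φ : OK →+* ZMod p := (e : _ →+* ZMod p).comp (Ideal.Quotient.mk (Ideal.span {π}))
  have hφe : ∀ x, φ x = e (Ideal.Quotient.mk _ x) := fun _ => rfl
  have hφ : ∀ x, φ x = 0 ↔ π ∣ x := by
    intro x
    rw [hφe, map_eq_zero_iff e e.injective, Ideal.Quotient.eq_zero_iff_mem,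
      Ideal.mem_span_singleton]
  obtain ⟨χ, h1, h3⟩ := exists_char hk hk0 φ
  have hNm : Nm π = p := by
    rw [Nm, Nat.card_congr e.toEquiv, Nat.card_eq_fintype_card, ZMod.card]
  have hcub : ∀ x, cubicCharP π x = χ (φ x) := by
    intro x
    have hex : (Nm π - 1) / 3 = k := by rw [hNm]; omega
    unfold cubicCharP
    split_ifs with h
    · obtain ⟨c1, c2, c3⟩ := h.choose_spec
      rw [← hφ] at c3
      apply phi_inj hk φ c1 (h3 _ c3)
      rw [← hφ, map_sub, map_pow, sub_eq_zero] at c2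
      rw [c2, h1, hex]
    · by_cases hx : φ x = 0
      · rw [hx, MulChar.map_zero]
      · exfalso
        apply h
        refine ⟨χ (φ x), h3 _ hx, ?_, by rwa [← hφ]⟩
        rw [← hφ, map_sub, map_pow, h1, hex, sub_self]
  have hkey := key hk hk0 π π' hπ3 hconj hfac' φ hφ χ h1 h3
  have ha0 : φ π' ≠ 0 := by
    intro h; rw [h, zero_pow hk0.ne'] at hkey; exact zero_ne_one hkey
  have hχa : χ (φ π') = 1 :=
    phi_inj hk φ (h3 _ ha0) (one_pow 3) (by rw [h1, hkey, map_one])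
  have hg : g A π = ∑ t : ZMod p, (χ t : ℂ) * ZMod.stdAddChar ((A : ZMod p) * t) := by
    have e1 : g A π
        = ∑ᶠ t : ZMod p, (χ t : ℂ) * ZMod.stdAddChar ((A : ZMod p) * (φ π' * t)) := by
      unfold g
      apply finsum_eq_of_bijective e e.bijective
      intro y
      have hy : φ (rep y) = e y := by
        rw [hφe]
        exact congrArg e (Function.surjInv_eq Ideal.Quotient.mk_surjective y)
      rw [exp_eq π π' hconj hfac' φ hφ, hcub, hy]
    rw [e1, finsum_eq_sum_of_fintype]
    refine Fintype.sum_equiv (Equiv.mulLeft₀ _ ha0) _ _ ?_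
    intro t
    simp [hχa]
  have hneg : χ (-1) = 1 := by
    have hn : (-1 : ZMod p) ≠ 0 := neg_ne_zero.2 one_ne_zero
    have h2 : χ (-1) ^ 2 = 1 := by rw [← map_pow]; simp
    have := h3 _ hn
    rw [pow_succ, h2, one_mul] at this
    exact this
  have hgc : (starRingEnd ℂ) (g A π)
      = ∑ t : ZMod p, (χ t : ℂ) ^ 2 * ZMod.stdAddChar ((A : ZMod p) * t) := by
    rw [hg, map_sum]
    refine Fintype.sum_equiv (Equiv.neg _) _ _ ?_
    intro t
    have hnt : χ (-t) = χ t := by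
      rw [← neg_one_mul, map_mul, hneg, one_mul]
    have hct : (starRingEnd ℂ) (χ t : ℂ) = (χ t : ℂ) ^ 2 := by
      by_cases ht : t = 0
      · rw [ht, MulChar.map_zero]; simp
      · exact conj_of_cube (congrArg Subtype.val (h3 t ht))
    rw [map_mul, hct, Equiv.neg_apply, hnt, mul_neg, AddChar.map_neg_eq_conj]
  rw [S_eq hk hk0 φ χ h1 h3 A hA0, hgc, hg, ← Finset.sum_add_distrib]
  exact Finset.sum_congr rfl fun t _ => add_mul _ _ _

end CubicAppendix
end
end
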